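/- Let (X,d) be a compact metric space, f : X → X continuous with h_top(f) < +∞, and φ, ψ ∈ C(X,ℝ) with ψ > 0. Then: (i) the set M_{ψ,φ}(X,f) of equilibrium states of P_ψ(φ) is convex; (ii) the extreme points of M_{ψ,φ}(X,f) are exactly the ergodic measures in M_{ψ,φ}(X,f); (iii) if M_{ψ,φ}(X,f) is non-empty, then it contains an ergodic measure. -/

import Mathlib

open Filter Set Topology MeasureTheory ENNReal

variable {X : Type*}

/-- Birkhoff sum `S_n φ = ∑_{i<n} φ ∘ f^i`. -/
def birkhoff (f : X → X) (φ : X → ℝ) (n : ℕ) (x : X) : ℝ :=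
  ∑ i ∈ Finset.range n, φ (f^[i] x)

section Metric
variable [MetricSpace X]

/-- `F` is an `(n,ε)`-spanning set of `Z`: every `y ∈ Z` is within Bowen distance
`d_n ≤ ε` of some point of `F`. -/
def IsSpanningSetOf (f : X → X) (n : ℕ) (ε : ℝ) (Z : Set X) (F : Finset X) : Prop :=
  ∀ y ∈ Z, ∃ x ∈ F, ∀ i < n, dist (f^[i] x) (f^[i] y) ≤ ε

/-- `E` is an `(n,ε)`-separated set of `Z`: `E ⊆ Z` and distinct points of `E` are at
Bowen distance `d_n > ε`. -/
def IsSeparatedSetOf (f : X → X) (n : ℕ) (ε : ℝ) (Z : Set X) (E : Finset X) : Prop :=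
  (E : Set X) ⊆ Z ∧ ∀ x ∈ E, ∀ y ∈ E, x ≠ y → ∃ i < n, ε < dist (f^[i] x) (f^[i] y)

/-- `S_T = {n : ℕ | ∃ x, S_nψ(x) ≤ T < S_{n+1}ψ(x)}`. -/
def inducedST (f : X → X) (ψ : X → ℝ) (T : ℝ) : Set ℕ :=
  {n | ∃ x : X, birkhoff f ψ n x ≤ T ∧ T < birkhoff f ψ (n + 1) x}

/-- `X_n = {x | S_nψ(x) ≤ T < S_{n+1}ψ(x)}`. -/
def inducedXn (f : X → X) (ψ : X → ℝ) (T : ℝ) (n : ℕ) : Set X :=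
  {x | birkhoff f ψ n x ≤ T ∧ T < birkhoff f ψ (n + 1) x}

/-- `Q_{ψ,T}(f,φ,ε)`: infimum over families of `(n,ε)`-spanning sets of the `X_n`, `n ∈ S_T`,
of `∑_{n ∈ S_T} ∑_{x ∈ F_n} e^{S_nφ(x)}`. -/
noncomputable def inducedQ (f : X → X) (ψ φ : X → ℝ) (T ε : ℝ) : ℝ≥0∞ :=
  ⨅ (F : ℕ → Finset X) (_ : ∀ n ∈ inducedST f ψ T,
      IsSpanningSetOf f n ε (inducedXn f ψ T n) (F n)),
    ∑' n : inducedST f ψ T, ∑ x ∈ F n, ENNReal.ofReal (Real.exp (birkhoff f φ n x))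

/-- `P_{ψ,T}(f,φ,ε)`: supremum over families of `(n,ε)`-separated sets of the `X_n`, `n ∈ S_T`,
of `∑_{n ∈ S_T} ∑_{x ∈ E_n} e^{S_nφ(x)}`. -/
noncomputable def inducedPsep (f : X → X) (ψ φ : X → ℝ) (T ε : ℝ) : ℝ≥0∞ :=
  ⨆ (E : ℕ → Finset X) (_ : ∀ n ∈ inducedST f ψ T,
      IsSeparatedSetOf f n ε (inducedXn f ψ T n) (E n)),
    ∑' n : inducedST f ψ T, ∑ x ∈ E n, ENNReal.ofReal (Real.exp (birkhoff f φ n x))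

/-- The ψ-induced topological pressure
`P_ψ(φ) = lim_{ε→0⁺} limsup_{T→∞} (1/T) log Q_{ψ,T}(f,φ,ε)`, the limit as `ε → 0⁺`
being realized as a `limsup` along `𝓝[>] 0` (since `ε ↦ limsup_T …` is monotone,
this coincides with the limit). -/
noncomputable def inducedPressure (f : X → X) (ψ φ : X → ℝ) : EReal :=
  limsup (fun ε : ℝ =>
    limsup (fun T : ℝ => ENNReal.log (inducedQ f ψ φ T ε) * ((T⁻¹ : ℝ) : EReal)) atTop)
    (𝓝[>] (0 : ℝ))

/-- Topological entropy `h_top(f) = P_ψ(0)` with `ψ ≡ 1`. -/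
noncomputable def topEntropy (f : X → X) : EReal :=
  inducedPressure f (fun _ => 1) (fun _ => 0)

end Metric
section Meas
variable [MetricSpace X] [MeasurableSpace X] [BorelSpace X]

/-- Entropy of the finite measurable partition of `X` induced by a map `q` into a finite
type: `H(q) = ∑_s -μ(q⁻¹{s}) log μ(q⁻¹{s})`. -/
noncomputable def mapEntropy {S : Type*} [Fintype S] (μ : Measure X) (q : X → S) : ℝ :=
  ∑ s : S, Real.negMulLog ((μ (q ⁻¹' {s})).toReal)

/-- Kolmogorov–Sinai (measure-theoretic) entropy `h_μ(f)`: the supremum, over finite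
measurable partitions (encoded as measurable maps `p : X → Fin k`), of
`lim_n (1/n) H(⋁_{i<n} f^{-i} p)`; the limit exists by subadditivity and is
realized here as a `liminf`. -/
noncomputable def measEntropy (f : X → X) (μ : Measure X) : EReal :=
  ⨆ (k : ℕ) (p : X → Fin k) (_ : Measurable p),
    liminf (fun n : ℕ =>
      (((n : ℝ)⁻¹ * mapEntropy μ (fun x (i : Fin n) => p (f^[i] x)) : ℝ) : EReal)) atTop

/-- The set `M(X,f)` of `f`-invariant Borel probability measures on `X`. -/
def invMeasures (f : X → X) : Set (Measure X) :=
  {μ | IsProbabilityMeasure μ ∧ ∀ B : Set X, MeasurableSet B → μ (f ⁻¹' B) = μ B}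

/-- `μ` is an equilibrium state of `P_ψ(φ)`:
`μ ∈ M(X,f)` and `P_ψ(φ) = (h_μ(f) + ∫φ dμ)/(∫ψ dμ)`. -/
noncomputable def equilibriumStates (f : X → X) (ψ φ : X → ℝ) : Set (Measure X) :=
  {μ | μ ∈ invMeasures f ∧
    inducedPressure f ψ φ =
      (measEntropy f μ + ((∫ x, φ x ∂μ : ℝ) : EReal)) / (((∫ x, ψ x ∂μ : ℝ) : EReal))}

end Meas

section Extreme
variable [MetricSpace X] [MeasurableSpace X] [BorelSpace X]

/-- `μ` is an extreme point of a set `S` of measures: `μ ∈ S` and whenever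
`μ = p μ₁ + (1-p) μ₂` with `μ₁, μ₂ ∈ S` and `0 < p < 1`, necessarily `μ₁ = μ₂ = μ`. -/
def IsExtremePointOf (S : Set (Measure X)) (μ : Measure X) : Prop :=
  μ ∈ S ∧ ∀ μ₁ ∈ S, ∀ μ₂ ∈ S, ∀ p : ℝ, 0 < p → p < 1 →
    μ = ENNReal.ofReal p • μ₁ + ENNReal.ofReal (1 - p) • μ₂ → μ₁ = μ ∧ μ₂ = μ

end Extreme

set_option linter.unusedSectionVars false

section EntropyBasics

theorem negMulLog_sum_le_sum {ι : Type*} (s : Finset ι) (p : ι → ℝ) (hp : ∀ i ∈ s, 0 ≤ p i) :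
    Real.negMulLog (∑ i ∈ s, p i) ≤ ∑ i ∈ s, Real.negMulLog (p i) := by
  have key : ∀ i ∈ s, p i * Real.log (p i) ≤ p i * Real.log (∑ j ∈ s, p j) := by
    intro i hi
    rcases (hp i hi).eq_or_lt with h | h
    · simp [← h]
    · exact mul_le_mul_of_nonneg_left
        (Real.log_le_log h (Finset.single_le_sum (f := p) hp hi)) h.le
  have := Finset.sum_le_sum key
  rw [← Finset.sum_mul] at this
  simp only [Real.negMulLog_eq_neg, Finset.sum_neg_distrib]
  linarith

/-- Gibbs' inequality. -/
theorem sum_negMulLog_le_of_sum_le {ι : Type*} [Fintype ι] (p q : ι → ℝ) (hp : ∀ i, 0 ≤ p i)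
    (hq : ∀ i, 0 ≤ q i) (hpq : ∀ i, q i = 0 → p i = 0) (hs : ∑ i, q i ≤ ∑ i, p i) :
    ∑ i, Real.negMulLog (p i) ≤ ∑ i, -(p i * Real.log (q i)) := by
  have key : ∀ i ∈ Finset.univ, Real.negMulLog (p i) ≤ -(p i * Real.log (q i)) + (q i - p i) := by
    intro i _
    rcases (hp i).eq_or_lt with h | h
    · simp [← h, hq i]
    · have hq' : 0 < q i := lt_of_le_of_ne (hq i) fun h0 => h.ne' (hpq i h0.symm)
      have h1 := Real.log_le_sub_one_of_pos (div_pos hq' h)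
      rw [Real.log_div hq'.ne' h.ne'] at h1
      have h2 := mul_le_mul_of_nonneg_left h1 h.le
      have h3 : p i * (q i / p i - 1) = q i - p i := by field_simp
      rw [Real.negMulLog_eq_neg]
      simp only
      linarith
  have := Finset.sum_le_sum key
  rw [Finset.sum_add_distrib, Finset.sum_sub_distrib] at this
  linarith

/-- All fibres of `q` are measurable. -/
def MeasurableFibers {X S : Type*} [MeasurableSpace X] (q : X → S) : Prop :=
  ∀ s, MeasurableSet (q ⁻¹' {s})

namespace MeasurableFibers

variable {X S T : Type*} [MeasurableSpace X] {q : X → S}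

theorem of_measurable [MeasurableSpace S] [MeasurableSingletonClass S] (hq : Measurable q) :
    MeasurableFibers q := fun s => hq (measurableSet_singleton s)

theorem preimage [Finite S] (hq : MeasurableFibers q) (B : Set S) : MeasurableSet (q ⁻¹' B) := by
  rw [← Set.biUnion_preimage_singleton]
  exact MeasurableSet.biUnion (Set.to_countable B) fun s _ => hq s

theorem comp_left [Finite S] (hq : MeasurableFibers q) (g : S → T) : MeasurableFibers (g ∘ q) :=
  fun t => by rw [Set.preimage_comp]; exact hq.preimage _

theorem comp_right (hq : MeasurableFibers q) {G : X → X} (hG : Measurable G) :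
    MeasurableFibers (q ∘ G) := fun s => hG (hq s)

theorem prodMk {r : X → T} (hq : MeasurableFibers q) (hr : MeasurableFibers r) :
    MeasurableFibers (fun x => (q x, r x)) := by
  rintro ⟨s, t⟩
  convert (hq s).inter (hr t) using 1
  ext x; simp

theorem pi {ι : Type*} [Finite ι] {r : ι → X → T} (hr : ∀ i, MeasurableFibers (r i)) :
    MeasurableFibers (fun x i => r i x) := by
  intro t
  convert MeasurableSet.iInter fun i => hr i (t i) using 1
  ext x; simp [funext_iff]

end MeasurableFibers

variable {X : Type*} [MetricSpace X] [MeasurableSpace X] [BorelSpace X]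
variable {S T A B C : Type*} [Fintype S] [Fintype T] [Fintype A] [Fintype B] [Fintype C]

theorem measureReal_fiber_comp (μ : Measure X) [IsFiniteMeasure μ] {q : X → S}
    (hq : MeasurableFibers q) (g : S → T) (t : T) [DecidableEq T] :
    μ.real ((g ∘ q) ⁻¹' {t}) = ∑ s with g s = t, μ.real (q ⁻¹' {s}) := by
  rw [sum_measureReal_preimage_singleton _ fun s _ => hq s]
  congr 1
  ext x; simp

theorem sum_measureReal_fiber_mul_comp (μ : Measure X) [IsFiniteMeasure μ] {q : X → S}
    (hq : MeasurableFibers q) (g : S → T) (w : T → ℝ) :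
    ∑ s, μ.real (q ⁻¹' {s}) * w (g s) = ∑ t, μ.real ((g ∘ q) ⁻¹' {t}) * w t := by
  classical
  rw [← Finset.sum_fiberwise (s := Finset.univ) (g := g)]
  refine Finset.sum_congr rfl fun t _ => ?_
  rw [measureReal_fiber_comp μ hq, Finset.sum_mul]
  refine Finset.sum_congr rfl fun s hs => ?_
  rw [(Finset.mem_filter.1 hs).2]

theorem sum_measureReal_fiber (μ : Measure X) [IsProbabilityMeasure μ] {q : X → S}
    (hq : MeasurableFibers q) : ∑ s, μ.real (q ⁻¹' {s}) = 1 := by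
  rw [sum_measureReal_preimage_singleton _ fun s _ => hq s]
  simp

theorem mapEntropy_nonneg (μ : Measure X) [IsProbabilityMeasure μ] (q : X → S) :
    0 ≤ mapEntropy μ q :=
  Finset.sum_nonneg fun _ _ => Real.negMulLog_nonneg ENNReal.toReal_nonneg measureReal_le_one

theorem mapEntropy_comp_le (μ : Measure X) [IsProbabilityMeasure μ] {q : X → S}
    (hq : MeasurableFibers q) (g : S → T) : mapEntropy μ (g ∘ q) ≤ mapEntropy μ q := by
  classical
  calc mapEntropy μ (g ∘ q)
      = ∑ t, Real.negMulLog (∑ s with g s = t, μ.real (q ⁻¹' {s})) := by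
        refine Finset.sum_congr rfl fun t _ => ?_
        rw [← measureReal_fiber_comp μ hq g t]; rfl
    _ ≤ ∑ t, ∑ s with g s = t, Real.negMulLog (μ.real (q ⁻¹' {s})) :=
        Finset.sum_le_sum fun t _ => negMulLog_sum_le_sum _ _ fun _ _ => measureReal_nonneg
    _ = mapEntropy μ q := Finset.sum_fiberwise _ _ _

theorem mapEntropy_le_of_factorsThrough (μ : Measure X) [IsProbabilityMeasure μ] {q : X → S}
    {r : X → T} (hr : MeasurableFibers r) (h : ∀ x y, r x = r y → q x = q y) :
    mapEntropy μ q ≤ mapEntropy μ r := by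
  have : Nonempty X := nonempty_of_isProbabilityMeasure μ
  have : Nonempty S := this.map q
  obtain ⟨g, rfl⟩ := (Function.factorsThrough_iff q).1 (fun x y hxy => h x y hxy)
  exact mapEntropy_comp_le μ hr g

theorem mapEntropy_eq_of_factorsThrough (μ : Measure X) [IsProbabilityMeasure μ] {q : X → S}
    {r : X → T} (hq : MeasurableFibers q) (hr : MeasurableFibers r)
    (h : ∀ x y, r x = r y ↔ q x = q y) : mapEntropy μ q = mapEntropy μ r :=
  le_antisymm (mapEntropy_le_of_factorsThrough μ hr fun x y => (h x y).1)
    (mapEntropy_le_of_factorsThrough μ hq fun x y => (h x y).2)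

theorem mapEntropy_comp_of_invariant {μ : Measure X} {G : X → X} (hG : MeasurePreserving G μ μ)
    {q : X → S} (hq : MeasurableFibers q) : mapEntropy μ (q ∘ G) = mapEntropy μ q := by
  refine Finset.sum_congr rfl fun s _ => ?_
  rw [Set.preimage_comp, hG.measure_preimage (hq s).nullMeasurableSet]

theorem mapEntropy_submodular (μ : Measure X) [IsProbabilityMeasure μ] {a : X → A} {b : X → B}
    {c : X → C} (ha : MeasurableFibers a) (hb : MeasurableFibers b) (hc : MeasurableFibers c) :
    mapEntropy μ (fun x => (a x, b x, c x)) + mapEntropy μ c ≤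
      mapEntropy μ (fun x => (a x, c x)) + mapEntropy μ (fun x => (b x, c x)) := by
  set q : X → A × B × C := fun x => (a x, b x, c x)
  have hq : MeasurableFibers q := ha.prodMk (hb.prodMk hc)
  set g₁ : A × B × C → A × C := fun s => (s.1, s.2.2)
  set g₂ : A × B × C → B × C := fun s => s.2
  set g₃ : A × B × C → C := fun s => s.2.2
  set p : A × B × C → ℝ := fun s => μ.real (q ⁻¹' {s})
  set u : A × C → ℝ := fun t => μ.real ((g₁ ∘ q) ⁻¹' {t}) with hu
  set v : B × C → ℝ := fun t => μ.real ((g₂ ∘ q) ⁻¹' {t}) with hv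
  set w : C → ℝ := fun t => μ.real ((g₃ ∘ q) ⁻¹' {t}) with hw
  have pu : ∀ s, p s ≤ u (g₁ s) := fun s =>
    measureReal_mono (by rintro x hx; simp only [mem_preimage, mem_singleton_iff] at hx; simp [hx])
  have pv : ∀ s, p s ≤ v (g₂ s) := fun s =>
    measureReal_mono (by rintro x hx; simp only [mem_preimage, mem_singleton_iff] at hx; simp [hx])
  have pw : ∀ s, p s ≤ w (g₃ s) := fun s =>
    measureReal_mono (by rintro x hx; simp only [mem_preimage, mem_singleton_iff] at hx; simp [hx])
  have p0 : ∀ s, 0 ≤ p s := fun s => measureReal_nonneg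
  have uw : ∀ γ, ∑ α, u (α, γ) = w γ := by
    intro γ
    rw [hw]
    have : (g₃ ∘ q) ⁻¹' {γ} = ⋃ α, (g₁ ∘ q) ⁻¹' {(α, γ)} := by ext x; simp [g₁, g₃, q]
    simp only [this]
    rw [measureReal_iUnion_fintype]
    · intro i j hij
      refine Set.disjoint_left.2 fun x hx hx' => hij ?_
      simp only [Function.comp, mem_preimage, mem_singleton_iff] at hx hx'
      exact (Prod.ext_iff.1 (hx.symm.trans hx')).1
    · exact fun i => hq.comp_left g₁ _
  have vw : ∀ γ, ∑ β, v (β, γ) = w γ := by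
    intro γ
    rw [hw]
    have : (g₃ ∘ q) ⁻¹' {γ} = ⋃ α, (g₂ ∘ q) ⁻¹' {(α, γ)} := by ext x; simp [g₂, g₃, q]
    simp only [this]
    rw [measureReal_iUnion_fintype]
    · intro i j hij
      refine Set.disjoint_left.2 fun x hx hx' => hij ?_
      simp only [Function.comp, mem_preimage, mem_singleton_iff] at hx hx'
      exact (Prod.ext_iff.1 (hx.symm.trans hx')).1
    · exact fun i => hq.comp_left g₂ _
  have key := sum_negMulLog_le_of_sum_le p (fun s => u (g₁ s) * v (g₂ s) / w (g₃ s)) p0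
    (fun s => div_nonneg (mul_nonneg measureReal_nonneg measureReal_nonneg) measureReal_nonneg)
    (by
      intro s hs
      refine le_antisymm ?_ (p0 s)
      rcases div_eq_zero_iff.1 hs with h | h
      · rcases mul_eq_zero.1 h with h | h
        · exact h ▸ pu s
        · exact h ▸ pv s
      · exact h ▸ pw s)
    (by
      have hp1 : ∑ s, p s = 1 := sum_measureReal_fiber μ hq
      have hw1 : ∑ s, w s = 1 := sum_measureReal_fiber μ (hq.comp_left g₃)
      rw [hp1, ← hw1, Fintype.sum_prod_type]
      simp only [Fintype.sum_prod_type, g₁, g₂, g₃]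
      rw [Finset.sum_congr rfl fun α _ => Finset.sum_comm, Finset.sum_comm]
      refine (Finset.sum_congr rfl fun γ _ => ?_).le
      simp_rw [← Finset.sum_div, ← Finset.mul_sum, vw, ← Finset.sum_mul, uw]
      rcases eq_or_ne (w γ) 0 with h | h
      · simp [h]
      · field_simp)
  have e : ∀ s, -(p s * Real.log (u (g₁ s) * v (g₂ s) / w (g₃ s))) =
      -(p s * Real.log (u (g₁ s))) + -(p s * Real.log (v (g₂ s))) + p s * Real.log (w (g₃ s)) := by
    intro s
    rcases (p0 s).eq_or_lt with h | h
    · simp [← h]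
    · have h1 := h.trans_le (pu s)
      have h2 := h.trans_le (pv s)
      have h3 := h.trans_le (pw s)
      rw [Real.log_div (by positivity) h3.ne', Real.log_mul h1.ne' h2.ne']
      ring
  rw [Finset.sum_congr rfl fun s _ => e s, Finset.sum_add_distrib, Finset.sum_add_distrib,
    Finset.sum_neg_distrib, Finset.sum_neg_distrib,
    sum_measureReal_fiber_mul_comp μ hq g₁ (fun t => Real.log (u t)),
    sum_measureReal_fiber_mul_comp μ hq g₂ (fun t => Real.log (v t)),
    sum_measureReal_fiber_mul_comp μ hq g₃ (fun t => Real.log (w t))] at key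
  have E0 : mapEntropy μ q = ∑ s, Real.negMulLog (p s) := rfl
  have E1 : mapEntropy μ (fun x => (a x, c x)) = -∑ t, u t * Real.log (u t) := by
    rw [← Finset.sum_neg_distrib]
    exact Finset.sum_congr rfl fun t _ => by rw [Real.negMulLog_eq_neg]; rfl
  have E2 : mapEntropy μ (fun x => (b x, c x)) = -∑ t, v t * Real.log (v t) := by
    rw [← Finset.sum_neg_distrib]
    exact Finset.sum_congr rfl fun t _ => by rw [Real.negMulLog_eq_neg]; rfl
  have E3 : mapEntropy μ c = -∑ t, w t * Real.log (w t) := by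
    rw [← Finset.sum_neg_distrib]
    exact Finset.sum_congr rfl fun t _ => by rw [Real.negMulLog_eq_neg]; rfl
  rw [E0, E1, E2, E3]
  linarith

theorem mapEntropy_prodMk_le (μ : Measure X) [IsProbabilityMeasure μ] {a : X → A} {b : X → B}
    (ha : MeasurableFibers a) (hb : MeasurableFibers b) :
    mapEntropy μ (fun x => (a x, b x)) ≤ mapEntropy μ a + mapEntropy μ b := by
  have hc : MeasurableFibers (fun _ : X => ()) := fun s => MeasurableSet.const _
  have h := mapEntropy_submodular μ ha hb hc
  rw [← mapEntropy_eq_of_factorsThrough μ (ha.prodMk hb) (ha.prodMk (hb.prodMk hc)) (by simp),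
    ← mapEntropy_eq_of_factorsThrough μ ha (ha.prodMk hc) (by simp),
    ← mapEntropy_eq_of_factorsThrough μ hb (hb.prodMk hc) (by simp)] at h
  linarith [mapEntropy_nonneg μ (fun _ : X => ())]

end EntropyBasics

section PartitionEntropy

variable {X : Type*} [MetricSpace X] [MeasurableSpace X] [BorelSpace X]
variable {S T : Type*} [Fintype S] [Fintype T]

/-- The coding of a point by the first `n` symbols of its itinerary through a partition. -/
def itinerary (f : X → X) (p : X → S) (n : ℕ) : X → Fin n → S := fun x i => p (f^[i] x)

variable {f : X → X} {μ : Measure X} [IsProbabilityMeasure μ] {p : X → S} {q : X → T}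

theorem itinerary_eq_iff {n : ℕ} {x y : X} :
    itinerary f p n x = itinerary f p n y ↔ ∀ i < n, p (f^[i] x) = p (f^[i] y) := by
  simp only [itinerary, funext_iff, Fin.forall_iff]

theorem MeasurableFibers.itinerary (hf : Measurable f) (hp : MeasurableFibers p) (n : ℕ) :
    MeasurableFibers (itinerary f p n) :=
  MeasurableFibers.pi fun i => hp.comp_right (hf.iterate i)

theorem mapEntropy_itinerary_prodMk_le (hf : MeasurePreserving f μ μ) (hp : MeasurableFibers p)
    (hq : MeasurableFibers q) (n : ℕ) :
    mapEntropy μ (fun x => (itinerary f p n x, itinerary f q n x)) ≤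
      mapEntropy μ (itinerary f q n) +
        n * (mapEntropy μ (fun x => (p x, q x)) - mapEntropy μ q) := by
  induction n with
  | zero =>
    rw [mapEntropy_eq_of_factorsThrough μ
      ((hp.itinerary hf.measurable 0).prodMk (hq.itinerary hf.measurable 0))
      (hq.itinerary hf.measurable 0) (by simp [itinerary_eq_iff])]
    simp
  | succ n ih =>
    have hP := hp.itinerary hf.measurable n
    have hQ := hq.itinerary hf.measurable n
    have ha := hp.comp_right (hf.iterate n).measurable
    have hb := hq.comp_right (hf.iterate n).measurable
    have hP' := hp.itinerary hf.measurable (n + 1)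
    have hQ' := hq.itinerary hf.measurable (n + 1)
    have s₁ := mapEntropy_submodular μ hP ha (hQ.prodMk hb)
    have s₂ := mapEntropy_submodular μ hP hb hQ
    have s₃ := mapEntropy_submodular μ ha hQ hb
    have e₁ := mapEntropy_eq_of_factorsThrough μ (hP'.prodMk hQ') (hP.prodMk (ha.prodMk
      (hQ.prodMk hb))) (by
        intro x y
        simp only [Prod.mk.injEq, itinerary_eq_iff, Nat.forall_lt_succ_right, Function.comp]
        tauto)
    have e₂ := mapEntropy_eq_of_factorsThrough μ hQ' (hQ.prodMk hb) (by
        intro x y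
        simp only [Prod.mk.injEq, itinerary_eq_iff, Nat.forall_lt_succ_right, Function.comp])
    have e₃ := mapEntropy_eq_of_factorsThrough μ (hP.prodMk (hb.prodMk hQ))
      (hP.prodMk (hQ.prodMk hb)) (by intro x y; simp only [Prod.mk.injEq]; tauto)
    have e₄ := mapEntropy_eq_of_factorsThrough μ (hb.prodMk hQ) (hQ.prodMk hb)
      (by intro x y; simp only [Prod.mk.injEq]; tauto)
    have e₅ : mapEntropy μ (fun x => ((p ∘ f^[n]) x, (q ∘ f^[n]) x)) =
        mapEntropy μ (fun x => (p x, q x)) :=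
      mapEntropy_comp_of_invariant (q := fun x => (p x, q x)) (hf.iterate n) (hp.prodMk hq)
    have e₆ := mapEntropy_comp_of_invariant (hf.iterate n) hq
    have arith : ∀ {X₁ Hc Y Z R Q PQ bQ b ab L M D K : ℝ}, X₁ + Hc ≤ Y + Z → R + Q ≤ PQ + bQ →
        Z + b ≤ ab + Hc → L = X₁ → M = Hc → R = Y → bQ = Hc → ab = D → b = K →
        PQ ≤ Q + n * (D - K) → L ≤ M + ((n + 1 : ℕ) : ℝ) * (D - K) := by
      intros
      push_cast
      linarith
    exact arith s₁ s₂ s₃ e₁ e₂ e₃ e₄ e₅ e₆ ih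

theorem mapEntropy_itinerary_add_le (hf : MeasurePreserving f μ μ) (hp : MeasurableFibers p)
    (m n : ℕ) :
    mapEntropy μ (itinerary f p (m + n)) ≤
      mapEntropy μ (itinerary f p m) + mapEntropy μ (itinerary f p n) := by
  have hm := hp.itinerary hf.measurable m
  have hn := hp.itinerary hf.measurable n
  have hn' := hn.comp_right (hf.iterate m).measurable
  rw [← mapEntropy_comp_of_invariant (hf.iterate m) hn]
  refine (mapEntropy_le_of_factorsThrough μ (hm.prodMk hn') ?_).trans (mapEntropy_prodMk_le μ hm hn')
  intro x y h
  simp only [Prod.mk.injEq, Function.comp, itinerary_eq_iff, ← Function.iterate_add_apply] at h ⊢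
  intro i hi
  rcases lt_or_ge i m with h' | h'
  · exact h.1 i h'
  · have := h.2 (i - m) (by omega)
    rwa [Nat.sub_add_cancel h'] at this

theorem mapEntropy_itinerary_mul_le (hf : Measurable f) (hp : MeasurableFibers p) (n k : ℕ) :
    mapEntropy μ (itinerary f p (n * k)) ≤
      mapEntropy μ (itinerary (f^[k]) (itinerary f p k) n) := by
  refine mapEntropy_le_of_factorsThrough μ ((hp.itinerary hf k).itinerary (hf.iterate k) n) ?_
  intro x y h
  simp only [itinerary_eq_iff, ← Function.iterate_mul, ← Function.iterate_add_apply] at h ⊢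
  intro i hi
  have hk : 0 < k := Nat.pos_of_ne_zero (by rintro rfl; simp at hi)
  have := h (i / k) ((Nat.div_lt_iff_lt_mul hk).2 hi) (i % k) (Nat.mod_lt _ hk)
  rwa [Nat.mod_add_div] at this

theorem mapEntropy_le_card (p : X → S) : mapEntropy μ p ≤ Fintype.card S := by
  refine (Finset.sum_le_card_nsmul _ _ 1 fun s _ => ?_).trans (by simp)
  have h : 0 ≤ (μ (p ⁻¹' {s})).toReal := ENNReal.toReal_nonneg
  exact (Real.negMulLog_le_one_sub_self h).trans (by linarith)

theorem mapEntropy_itinerary_le (hf : MeasurePreserving f μ μ) (hp : MeasurableFibers p) (n : ℕ) :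
    mapEntropy μ (itinerary f p n) ≤ n * Fintype.card S := by
  induction n with
  | zero =>
    have : mapEntropy μ (itinerary f p 0) ≤ mapEntropy μ (fun _ : X => ()) :=
      mapEntropy_le_of_factorsThrough μ (fun s => MeasurableSet.const _)
        (by simp [itinerary_eq_iff])
    simpa [mapEntropy] using this
  | succ n ih =>
    have h₁ : mapEntropy μ (itinerary f p 1) ≤ mapEntropy μ p :=
      mapEntropy_le_of_factorsThrough μ hp (by simp [itinerary_eq_iff])
    have := mapEntropy_itinerary_add_le hf hp n 1
    have := mapEntropy_le_card (μ := μ) p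
    push_cast
    linarith

/-- The entropy `h_μ(f, p) = lim_n (1/n) H(⋁_{i<n} f^{-i} p)` of `f` with respect to the
partition `p`. -/
noncomputable def partitionEntropy (f : X → X) (μ : Measure X) (p : X → S) : ℝ :=
  limUnder atTop fun n : ℕ => mapEntropy μ (itinerary f p n) / n

theorem tendsto_partitionEntropy (hf : MeasurePreserving f μ μ) (hp : MeasurableFibers p) :
    Tendsto (fun n : ℕ => mapEntropy μ (itinerary f p n) / n) atTop
      (𝓝 (partitionEntropy f μ p)) := by
  have h : Subadditive fun n => mapEntropy μ (itinerary f p n) :=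
    fun m n => mapEntropy_itinerary_add_le hf hp m n
  refine tendsto_nhds_limUnder ⟨_, h.tendsto_lim ⟨0, ?_⟩⟩
  rintro _ ⟨n, rfl⟩
  exact div_nonneg (mapEntropy_nonneg _ _) n.cast_nonneg

theorem partitionEntropy_nonneg (hf : MeasurePreserving f μ μ) (hp : MeasurableFibers p) :
    0 ≤ partitionEntropy f μ p :=
  ge_of_tendsto' (tendsto_partitionEntropy hf hp) fun n =>
    div_nonneg (mapEntropy_nonneg _ _) n.cast_nonneg

theorem partitionEntropy_mono (hf : MeasurePreserving f μ μ) (hp : MeasurableFibers p)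
    (hq : MeasurableFibers q) (h : ∀ x y, q x = q y → p x = p y) :
    partitionEntropy f μ p ≤ partitionEntropy f μ q := by
  refine le_of_tendsto_of_tendsto' (tendsto_partitionEntropy hf hp)
    (tendsto_partitionEntropy hf hq) fun n => ?_
  gcongr
  refine mapEntropy_le_of_factorsThrough μ (hq.itinerary hf.measurable n) fun x y hxy => ?_
  rw [itinerary_eq_iff] at hxy ⊢
  exact fun i hi => h _ _ (hxy i hi)

theorem MeasurableFibers.measurable_fin {k : ℕ} {p : X → Fin k} (hp : MeasurableFibers p) :
    Measurable p := measurable_to_countable' hp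

theorem measEntropy_eq (hf : MeasurePreserving f μ μ) :
    measEntropy f μ = ⨆ (k : ℕ) (p : X → Fin k) (_ : Measurable p),
      (partitionEntropy f μ p : EReal) := by
  refine iSup_congr fun k => iSup_congr fun p => iSup_congr fun hp => ?_
  refine Tendsto.liminf_eq ?_
  refine (continuous_coe_real_ereal.tendsto _).comp ?_
  refine (tendsto_partitionEntropy hf (MeasurableFibers.of_measurable hp)).congr fun n => ?_
  rw [div_eq_inv_mul]; rfl

theorem partitionEntropy_le_measEntropy (hf : MeasurePreserving f μ μ) (hp : MeasurableFibers p) :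
    (partitionEntropy f μ p : EReal) ≤ measEntropy f μ := by
  rw [measEntropy_eq hf]
  let e := Fintype.equivFin S
  have hp' : MeasurableFibers (e ∘ p) := hp.comp_left e
  refine le_trans ?_ (le_iSup_of_le (Fintype.card S) (le_iSup₂_of_le (e ∘ p)
    hp'.measurable_fin le_rfl))
  exact EReal.coe_le_coe_iff.2 (partitionEntropy_mono hf hp hp' fun x y h => e.injective h)

theorem measEntropy_le_iff (hf : MeasurePreserving f μ μ) {c : EReal} :
    measEntropy f μ ≤ c ↔ ∀ (k : ℕ) (p : X → Fin k), MeasurableFibers p →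
      (partitionEntropy f μ p : EReal) ≤ c := by
  rw [measEntropy_eq hf]
  simp only [iSup_le_iff]
  exact forall₂_congr fun k p =>
    ⟨fun h hp => h hp.measurable_fin, fun h hp => h (MeasurableFibers.of_measurable hp)⟩

theorem measEntropy_nonneg (hf : MeasurePreserving f μ μ) : 0 ≤ measEntropy f μ := by
  have hp : MeasurableFibers (fun _ : X => ()) := fun s => MeasurableSet.const _
  exact le_trans (EReal.coe_nonneg.2 (partitionEntropy_nonneg hf hp))
    (partitionEntropy_le_measEntropy hf hp)

theorem exists_lt_partitionEntropy (hf : MeasurePreserving f μ μ) {c : EReal}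
    (hc : c < measEntropy f μ) :
    ∃ (k : ℕ) (p : X → Fin k), MeasurableFibers p ∧ c < partitionEntropy f μ p := by
  by_contra! h
  exact hc.not_ge ((measEntropy_le_iff hf).2 h)

end PartitionEntropy

section Mixture

variable {X : Type*} [MetricSpace X] [MeasurableSpace X] [BorelSpace X]
variable {S : Type*} [Fintype S] {f : X → X} {μ ν : Measure X}

/-- The convex combination `t μ + (1 - t) ν`. -/
noncomputable def mixture (t : ℝ) (μ ν : Measure X) : Measure X :=
  ENNReal.ofReal t • μ + ENNReal.ofReal (1 - t) • ν

variable [IsProbabilityMeasure μ] [IsProbabilityMeasure ν] {t : ℝ}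

theorem isProbabilityMeasure_mixture (h0 : 0 ≤ t) (h1 : t ≤ 1) :
    IsProbabilityMeasure (mixture t μ ν) := by
  constructor
  simp only [mixture, Measure.add_apply, Measure.smul_apply, measure_univ, smul_eq_mul, mul_one]
  rw [← ENNReal.ofReal_add h0 (by linarith)]
  simp

theorem measurePreserving_mixture (hμ : MeasurePreserving f μ μ) (hν : MeasurePreserving f ν ν) :
    MeasurePreserving f (mixture t μ ν) (mixture t μ ν) :=
  (hμ.smul_measure _).add_measure (hν.smul_measure _)

theorem measureReal_mixture (h0 : 0 ≤ t) (h1 : t ≤ 1) (s : Set X) :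
    (mixture t μ ν s).toReal = t * (μ s).toReal + (1 - t) * (ν s).toReal := by
  simp only [mixture, Measure.add_apply, Measure.smul_apply, smul_eq_mul]
  rw [ENNReal.toReal_add (by finiteness) (by finiteness), ENNReal.toReal_mul, ENNReal.toReal_mul,
    ENNReal.toReal_ofReal h0, ENNReal.toReal_ofReal (by linarith)]

theorem integral_mixture (h0 : 0 ≤ t) (h1 : t ≤ 1) {g : X → ℝ} (hμ : Integrable g μ)
    (hν : Integrable g ν) :
    ∫ x, g x ∂(mixture t μ ν) = t * ∫ x, g x ∂μ + (1 - t) * ∫ x, g x ∂ν := by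
  rw [mixture, integral_add_measure (hμ.smul_measure (by finiteness))
    (hν.smul_measure (by finiteness)), integral_smul_measure, integral_smul_measure,
    ENNReal.toReal_ofReal h0, ENNReal.toReal_ofReal (by linarith)]
  simp

theorem le_mapEntropy_mixture (h0 : 0 ≤ t) (h1 : t ≤ 1) (p : X → S) :
    t * mapEntropy μ p + (1 - t) * mapEntropy ν p ≤ mapEntropy (mixture t μ ν) p := by
  simp only [mapEntropy, Finset.mul_sum, ← Finset.sum_add_distrib]
  refine Finset.sum_le_sum fun s _ => ?_
  rw [measureReal_mixture h0 h1]
  exact Real.concaveOn_negMulLog.2 ENNReal.toReal_nonneg ENNReal.toReal_nonneg h0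
    (by linarith) (by ring)

theorem mapEntropy_mixture_le (h0 : 0 ≤ t) (h1 : t ≤ 1) {p : X → S} (hp : MeasurableFibers p) :
    mapEntropy (mixture t μ ν) p ≤ t * mapEntropy μ p + (1 - t) * mapEntropy ν p + 2 := by
  have hμ := sum_measureReal_fiber μ hp
  have hν := sum_measureReal_fiber ν hp
  simp only [Measure.real] at hμ hν
  have key : ∀ s ∈ Finset.univ, Real.negMulLog ((mixture t μ ν (p ⁻¹' {s})).toReal) ≤
      t * Real.negMulLog ((μ (p ⁻¹' {s})).toReal) +
      (1 - t) * Real.negMulLog ((ν (p ⁻¹' {s})).toReal) +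
      ((μ (p ⁻¹' {s})).toReal * Real.negMulLog t +
        (ν (p ⁻¹' {s})).toReal * Real.negMulLog (1 - t)) := by
    intro s _
    rw [measureReal_mixture h0 h1]
    have := negMulLog_sum_le_sum Finset.univ
      ![t * (μ (p ⁻¹' {s})).toReal, (1 - t) * (ν (p ⁻¹' {s})).toReal] (by
        have : 0 ≤ 1 - t := by linarith
        intro i _
        fin_cases i <;> simp <;> positivity)
    simp only [Fin.sum_univ_two, Matrix.cons_val_zero, Matrix.cons_val_one,
      Real.negMulLog_mul] at this
    linarith
  have h := Finset.sum_le_sum key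
  rw [Finset.sum_add_distrib, Finset.sum_add_distrib, Finset.sum_add_distrib, ← Finset.sum_mul,
    ← Finset.sum_mul, ← Finset.mul_sum, ← Finset.mul_sum, hμ, hν] at h
  have := Real.negMulLog_le_one_sub_self h0
  have := Real.negMulLog_le_one_sub_self (x := 1 - t) (by linarith)
  simp only [mapEntropy]
  linarith

theorem partitionEntropy_mixture (hμ : MeasurePreserving f μ μ) (hν : MeasurePreserving f ν ν)
    (h0 : 0 ≤ t) (h1 : t ≤ 1) {p : X → S} (hp : MeasurableFibers p) :
    partitionEntropy f (mixture t μ ν) p =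
      t * partitionEntropy f μ p + (1 - t) * partitionEntropy f ν p := by
  have := isProbabilityMeasure_mixture (μ := μ) (ν := ν) h0 h1
  have l₁ := tendsto_partitionEntropy (measurePreserving_mixture (t := t) hμ hν) hp
  have l₂ := ((tendsto_partitionEntropy hμ hp).const_mul t).add
    ((tendsto_partitionEntropy hν hp).const_mul (1 - t))
  have l₃ := l₂.add (tendsto_const_div_atTop_nhds_zero_nat (2 : ℝ))
  refine le_antisymm ?_ (le_of_tendsto_of_tendsto' l₂ l₁ fun n => ?_)
  · rw [add_zero] at l₃
    refine le_of_tendsto_of_tendsto' l₁ l₃ fun n => ?_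
    rw [← mul_div_assoc, ← mul_div_assoc, ← add_div, ← add_div]
    gcongr
    exact mapEntropy_mixture_le h0 h1 (hp.itinerary hμ.measurable n)
  · rw [← mul_div_assoc, ← mul_div_assoc, ← add_div]
    gcongr
    exact le_mapEntropy_mixture h0 h1 _

theorem measEntropy_mixture (hμ : MeasurePreserving f μ μ) (hν : MeasurePreserving f ν ν)
    (h0 : 0 ≤ t) (h1 : t ≤ 1) {a b : ℝ} (ha : measEntropy f μ = a) (hb : measEntropy f ν = b) :
    measEntropy f (mixture t μ ν) = ((t * a + (1 - t) * b : ℝ) : EReal) := by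
  have := isProbabilityMeasure_mixture (μ := μ) (ν := ν) h0 h1
  have h1' : 0 ≤ 1 - t := by linarith
  have hm := measurePreserving_mixture (t := t) hμ hν
  have le : measEntropy f (mixture t μ ν) ≤ ((t * a + (1 - t) * b : ℝ) : EReal) := by
    rw [measEntropy_le_iff hm]
    intro k p hp
    rw [partitionEntropy_mixture hμ hν h0 h1 hp, EReal.coe_le_coe_iff]
    have pa := partitionEntropy_le_measEntropy hμ hp
    have pb := partitionEntropy_le_measEntropy hν hp
    rw [ha, EReal.coe_le_coe_iff] at pa
    rw [hb, EReal.coe_le_coe_iff] at pb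
    gcongr
  refine le.antisymm ?_
  lift measEntropy f (mixture t μ ν) to ℝ using
    ⟨(le.trans_lt (EReal.coe_lt_top _)).ne, (EReal.bot_lt_zero.trans_le (measEntropy_nonneg hm)).ne'⟩
    with c hc
  rw [EReal.coe_le_coe_iff]
  refine le_of_forall_pos_le_add fun δ hδ => ?_
  obtain ⟨k, p, hp, hpa⟩ := exists_lt_partitionEntropy hμ (c := ((a - δ : ℝ) : EReal))
    (by rw [ha, EReal.coe_lt_coe_iff]; linarith)
  obtain ⟨l, q, hq, hqb⟩ := exists_lt_partitionEntropy hν (c := ((b - δ : ℝ) : EReal))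
    (by rw [hb, EReal.coe_lt_coe_iff]; linarith)
  rw [EReal.coe_lt_coe_iff] at hpa hqb
  have hpq := hp.prodMk hq
  have h₁ := partitionEntropy_mono hμ hp hpq (by simp +contextual)
  have h₂ := partitionEntropy_mono hν hq hpq (by simp +contextual)
  have h₃ := partitionEntropy_le_measEntropy hm hpq
  rw [← hc, EReal.coe_le_coe_iff, partitionEntropy_mixture hμ hν h0 h1 hpq] at h₃
  have h₄ := mul_le_mul_of_nonneg_left (hpa.le.trans h₁) h0
  have h₅ := mul_le_mul_of_nonneg_left (hqb.le.trans h₂) h1'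
  linarith

end Mixture

section Pressure

theorem sum_biUnion_le_sum_sum {ι α : Type*} [DecidableEq α] (s : Finset ι) (t : ι → Finset α)
    (g : α → ℝ) (hg : ∀ x, 0 ≤ g x) :
    ∑ x ∈ s.biUnion t, g x ≤ ∑ i ∈ s, ∑ x ∈ t i, g x := by
  classical
  induction s using Finset.induction_on with
  | empty => simp
  | insert a s ha ih =>
    rw [Finset.biUnion_insert, Finset.sum_insert ha]
    have h := Finset.sum_union_inter (s₁ := t a) (s₂ := s.biUnion t) (f := g)
    have h' : 0 ≤ ∑ x ∈ t a ∩ s.biUnion t, g x := Finset.sum_nonneg fun x _ => hg x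
    linarith

theorem eventually_mul_exp_le_exp (L : ℕ) (A : ℝ) {ω : ℝ} (hω : 0 < ω) :
    ∀ᶠ n : ℕ in atTop, ((n * L + 2 : ℕ) : ℝ) * Real.exp A ≤ Real.exp (n * ω) := by
  have h := ((isLittleO_pow_exp_pos_mul_atTop 1 hω).comp_tendsto
    tendsto_natCast_atTop_atTop).def (c := (((L + 2 : ℕ) : ℝ) * Real.exp A)⁻¹) (by positivity)
  filter_upwards [h, eventually_ge_atTop 1] with n hn hn1
  simp only [Function.comp, pow_one, Real.norm_eq_abs, Real.abs_exp, Nat.abs_cast] at hn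
  rw [inv_mul_eq_div, le_div_iff₀ (by positivity), mul_comm ω] at hn
  refine le_trans ?_ hn
  have : ((n * L + 2 : ℕ) : ℝ) ≤ n * ((L + 2 : ℕ) : ℝ) := by
    exact_mod_cast (by nlinarith : n * L + 2 ≤ n * (L + 2))
  rw [← mul_assoc]
  gcongr

variable {X : Type*} {f : X → X} {φ ψ : X → ℝ}

theorem birkhoff_succ (n : ℕ) (x : X) : birkhoff f ψ (n + 1) x = birkhoff f ψ n x + ψ (f^[n] x) :=
  Finset.sum_range_succ _ _

theorem abs_birkhoff_sub_le {n : ℕ} {x y : X} {δ : ℝ}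
    (h : ∀ i < n, |ψ (f^[i] x) - ψ (f^[i] y)| ≤ δ) :
    |birkhoff f ψ n x - birkhoff f ψ n y| ≤ n * δ := by
  rw [birkhoff, birkhoff, ← Finset.sum_sub_distrib]
  refine (Finset.abs_sum_le_sum_abs _ _).trans ?_
  refine (Finset.sum_le_card_nsmul _ _ δ fun i hi => h i (Finset.mem_range.1 hi)).trans ?_
  simp

theorem birkhoff_sub_const_mul (β : ℝ) (n : ℕ) (x : X) :
    birkhoff f (fun x => φ x - β * ψ x) n x = birkhoff f φ n x - β * birkhoff f ψ n x := by
  simp [birkhoff, Finset.sum_sub_distrib, Finset.mul_sum]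

variable [MetricSpace X]

theorem exists_spanning_of_inducedQ_lt {T ε β : ℝ} (hT : 0 < T)
    (h : ENNReal.log (inducedQ f ψ φ T ε) * ((T⁻¹ : ℝ) : EReal) < β) :
    ∀ n ∈ inducedST f ψ T, ∃ F : Finset X, IsSpanningSetOf f n ε (inducedXn f ψ T n) F ∧
      ∑ x ∈ F, Real.exp (birkhoff f φ n x) ≤ Real.exp (β * T) := by
  rw [EReal.coe_inv, ← div_eq_mul_inv, EReal.div_lt_iff (by exact_mod_cast hT)
    (EReal.coe_ne_top T), ← EReal.coe_mul, ← Real.log_exp (β * T),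
    ← ENNReal.log_ofReal_of_pos (Real.exp_pos _), ENNReal.log_lt_log_iff, inducedQ] at h
  simp only [iInf_lt_iff] at h
  obtain ⟨F, hF, hlt⟩ := h
  intro n hn
  refine ⟨F n, hF n hn, ?_⟩
  have := (ENNReal.le_tsum (f := fun n : inducedST f ψ T =>
    ∑ x ∈ F n, ENNReal.ofReal (Real.exp (birkhoff f φ n x))) ⟨n, hn⟩).trans hlt.le
  rwa [← ENNReal.ofReal_sum_of_nonneg fun _ _ => (Real.exp_pos _).le,
    ENNReal.ofReal_le_ofReal_iff (Real.exp_pos _).le] at this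

variable [CompactSpace X] [Nonempty X]

theorem eventually_exists_spanning (hψ : Continuous ψ) (hψpos : ∀ x, 0 < ψ x) {β : ℝ}
    (hβ : inducedPressure f ψ φ < β) {ω : ℝ} (hω : 0 < ω) :
    ∀ᶠ ε in 𝓝[>] (0 : ℝ), ∀ᶠ n : ℕ in atTop, ∃ F : Finset X,
      IsSpanningSetOf f n ε univ F ∧
      ∑ x ∈ F, Real.exp (birkhoff f (fun x => φ x - β * ψ x) n x) ≤ Real.exp (n * ω) := by
  classical
  obtain ⟨m, hm, hmψ⟩ : ∃ m > 0, ∀ x, m ≤ ψ x := by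
    obtain ⟨x, hx⟩ := hψ.exists_forall_le_of_hasCompactSupport
      (HasCompactSupport.of_compactSpace _)
    exact ⟨ψ x, hψpos x, hx⟩
  obtain ⟨M, hMψ⟩ : ∃ M, ∀ x, ψ x ≤ M := by
    obtain ⟨x, hx⟩ := hψ.exists_forall_ge_of_hasCompactSupport
      (HasCompactSupport.of_compactSpace _)
    exact ⟨ψ x, hx⟩
  have hM : 0 < M := hm.trans_le ((hmψ (Classical.arbitrary X)).trans (hMψ _))
  set ω' : ℝ := (ω / 2) / (|β| + 1) with hω'
  have hω'0 : 0 < ω' := by positivity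
  have hβω : |β| * ω' ≤ ω / 2 := by
    rw [hω', ← mul_div_assoc, div_le_iff₀ (by positivity)]
    nlinarith [abs_nonneg β]
  have hunif : ∀ᶠ ε in 𝓝[>] (0 : ℝ), ∀ x y, dist x y ≤ ε → |ψ x - ψ y| ≤ ω' := by
    obtain ⟨δ, hδ, h⟩ := Metric.uniformContinuous_iff.1
      (CompactSpace.uniformContinuous_of_continuous hψ) ω' hω'0
    filter_upwards [Ioo_mem_nhdsGT hδ] with ε hε x y hxy
    exact (h (hxy.trans_lt hε.2)).le
  filter_upwards [hunif, eventually_lt_of_limsup_lt hβ] with ε hε hlim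
  obtain ⟨T₀, hT₀⟩ := eventually_atTop.1 ((eventually_lt_of_limsup_lt hlim).and
    (eventually_gt_atTop 0))
  set L : ℕ := ⌈M / m⌉₊
  have hlarge : ∀ᶠ n : ℕ in atTop, T₀ ≤ n * m :=
    (tendsto_natCast_atTop_atTop.atTop_mul_const hm).eventually_ge_atTop T₀
  filter_upwards [hlarge, eventually_mul_exp_le_exp L (|β| * M) (half_pos hω)] with n hn hexp
  have hlow : ∀ (n : ℕ) x, n * m ≤ birkhoff f ψ n x := fun n x => by
    have := Finset.card_nsmul_le_sum (Finset.range n) (fun i => ψ (f^[i] x)) m fun i _ => hmψ _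
    simpa [birkhoff] using this
  have hup : ∀ (n : ℕ) x, birkhoff f ψ n x ≤ n * M := fun n x => by
    have := Finset.sum_le_card_nsmul (Finset.range n) (fun i => ψ (f^[i] x)) M fun i _ => hMψ _
    simpa [birkhoff] using this
  have piece : ∀ k : ℕ, ∃ F : Finset X, IsSpanningSetOf f n ε (inducedXn f ψ (k * m) n) F ∧
      ∑ x ∈ F, Real.exp (birkhoff f (fun x => φ x - β * ψ x) n x) ≤
        Real.exp (|β| * M) * Real.exp (n * (ω / 2)) := by
    intro k
    by_cases hk : n ∈ inducedST f ψ (k * m)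
    · have hT : T₀ ≤ k * m := by
        obtain ⟨x, hx, -⟩ := hk
        exact hn.trans ((hlow n x).trans hx)
      obtain ⟨F, hF, hsum⟩ := exists_spanning_of_inducedQ_lt (hT₀ _ hT).2 (hT₀ _ hT).1 n hk
      set F' := F.filter fun x => ∃ y ∈ inducedXn f ψ (k * m) n,
        ∀ i < n, dist (f^[i] x) (f^[i] y) ≤ ε
      refine ⟨F', fun y hy => ?_, ?_⟩
      · obtain ⟨x, hx, hxy⟩ := hF y hy
        exact ⟨x, Finset.mem_filter.2 ⟨hx, y, hy, hxy⟩, hxy⟩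
      · have pt : ∀ x ∈ F', Real.exp (birkhoff f (fun x => φ x - β * ψ x) n x) ≤
            Real.exp (birkhoff f φ n x) * (Real.exp (-(β * (k * m))) *
              (Real.exp (|β| * M) * Real.exp (n * (ω / 2)))) := by
          intro x hx
          obtain ⟨-, y, ⟨hy₁, hy₂⟩, hxy⟩ := Finset.mem_filter.1 hx
          rw [birkhoff_succ] at hy₂
          rw [← Real.exp_add, ← Real.exp_add, ← Real.exp_add, Real.exp_le_exp,
            birkhoff_sub_const_mul]
          have h₁ := abs_le.1 (abs_birkhoff_sub_le (ψ := ψ) (δ := ω') fun i hi =>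
            hε _ _ (hxy i hi))
          have h₂ : |k * m - birkhoff f ψ n x| ≤ M + n * ω' := by
            have := hMψ (f^[n] y)
            rw [abs_le]
            constructor <;> linarith [h₁.1, h₁.2]
          have h₃ : β * (k * m - birkhoff f ψ n x) ≤ |β| * (M + n * ω') := by
            refine (le_abs_self _).trans ?_
            rw [abs_mul]
            gcongr
          have h₄ : n * (|β| * ω') ≤ n * (ω / 2) := by gcongr
          nlinarith
        refine (Finset.sum_le_sum pt).trans ?_
        rw [← Finset.sum_mul, ← mul_assoc]
        have h₁ : ∑ x ∈ F', Real.exp (birkhoff f φ n x) ≤ Real.exp (β * (k * m)) :=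
          (Finset.sum_le_sum_of_subset_of_nonneg (Finset.filter_subset _ _)
            fun _ _ _ => (Real.exp_pos _).le).trans hsum
        have h₂ : (∑ x ∈ F', Real.exp (birkhoff f φ n x)) * Real.exp (-(β * (k * m))) ≤ 1 := by
          refine (mul_le_mul_of_nonneg_right h₁ (Real.exp_pos _).le).trans ?_
          rw [← Real.exp_add]
          simp
        exact mul_le_of_le_one_left (by positivity) h₂
    · exact ⟨∅, fun y hy => (hk ⟨y, hy⟩).elim, by simp; positivity⟩
  choose F hF hsum using piece
  refine ⟨(Finset.range (n * L + 2)).biUnion F, fun y _ => ?_, ?_⟩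
  · set k : ℕ := ⌈birkhoff f ψ n y / m⌉₊
    have h0 : 0 ≤ birkhoff f ψ n y := le_trans (by positivity) (hlow n y)
    have hk₁ : birkhoff f ψ n y ≤ k * m := (div_le_iff₀ hm).1 (Nat.le_ceil _)
    have hk₂ : k < birkhoff f ψ n y / m + 1 := Nat.ceil_lt_add_one (by positivity)
    have hk₃ : k * m < birkhoff f ψ n y + m := by
      have := mul_lt_mul_of_pos_right hk₂ hm
      rwa [add_mul, div_mul_cancel₀ _ hm.ne', one_mul] at this
    obtain ⟨x, hx, hxy⟩ := hF k y ⟨hk₁, by rw [birkhoff_succ]; linarith [hmψ (f^[n] y)]⟩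
    refine ⟨x, Finset.mem_biUnion.2 ⟨k, Finset.mem_range.2 ?_, hx⟩, hxy⟩
    have : (k : ℝ) < n * L + 2 := by
      have h₁ : birkhoff f ψ n y / m ≤ n * (M / m) := by
        rw [← mul_div_assoc]; gcongr; exact hup n y
      have h₂ : (n : ℝ) * (M / m) ≤ n * L := by gcongr; exact Nat.le_ceil _
      linarith
    exact_mod_cast this
  · refine (sum_biUnion_le_sum_sum _ _ _ fun _ => (Real.exp_pos _).le).trans ?_
    refine (Finset.sum_le_card_nsmul _ _ _ fun k _ => hsum k).trans ?_
    rw [Finset.card_range, nsmul_eq_mul, ← mul_assoc]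
    calc _ ≤ Real.exp (n * (ω / 2)) * Real.exp (n * (ω / 2)) := by gcongr
      _ = Real.exp (n * ω) := by rw [← Real.exp_add]; ring_nf

end Pressure

section Variational

variable {X : Type*} [MetricSpace X] [MeasurableSpace X] [BorelSpace X]
variable {S T : Type*} [Fintype S] [Fintype T] {f : X → X} {μ : Measure X}

theorem integral_comp_eq_sum_fiber [IsFiniteMeasure μ] {q : X → S} (hq : MeasurableFibers q)
    (w : S → ℝ) :
    Integrable (fun x => w (q x)) μ ∧ ∫ x, w (q x) ∂μ = ∑ s, μ.real (q ⁻¹' {s}) * w s := by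
  classical
  have h : (fun x => w (q x)) = fun x => ∑ s, (q ⁻¹' {s}).indicator (fun _ => w s) x := by
    ext x
    simp [Set.indicator_apply]
  have hi : ∀ s ∈ Finset.univ, Integrable ((q ⁻¹' {s}).indicator fun _ => w s) μ :=
    fun s _ => (integrable_const _).indicator (hq s)
  rw [h]
  refine ⟨integrable_finsetSum _ hi, ?_⟩
  rw [integral_finsetSum _ hi]
  exact Finset.sum_congr rfl fun s _ => by rw [integral_indicator_const _ (hq s), smul_eq_mul]

theorem exists_separated_approx [CompactSpace X] [IsProbabilityMeasure μ] {p : X → S}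
    (hp : MeasurableFibers p) :
    ∃ η : X → Option S, MeasurableFibers η ∧
      mapEntropy μ (fun x => (p x, η x)) ≤ mapEntropy μ η + 1 ∧
      ∀ᶠ r in 𝓝[>] (0 : ℝ), ∀ y y' a b, η y = some a → η y' = some b → a ≠ b → r < dist y y' := by
  classical
  obtain ⟨δ, hδ, hδS⟩ : ∃ δ > 0, ∀ x, 0 ≤ x → x < δ →
      Real.negMulLog x ≤ ((Fintype.card S : ℝ) + 1)⁻¹ := by
    have h := (Real.continuous_negMulLog.tendsto 0).eventually_le_const
      (u := ((Fintype.card S : ℝ) + 1)⁻¹) (by simp; positivity)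
    obtain ⟨δ, hδ, h⟩ := Metric.eventually_nhds_iff.1 h
    exact ⟨δ, hδ, fun x h0 hx => h (by simpa [abs_of_nonneg h0] using hx)⟩
  have hK : ∀ s, ∃ K ⊆ p ⁻¹' {s}, IsCompact K ∧ μ (p ⁻¹' {s} \ K) < ENNReal.ofReal δ :=
    fun s => (hp s).exists_isCompact_sdiff_lt (by finiteness) (by simpa using hδ)
  choose K hKp hKc hKδ using hK
  set η : X → Option S := fun x => if x ∈ K (p x) then some (p x) else none with hη
  have hsome : ∀ x s, η x = some s ↔ x ∈ K s := by
    intro x s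
    simp only [hη]
    constructor
    · intro h
      split_ifs at h with hx
      obtain rfl : p x = s := by simpa using h
      exact hx
    · intro h
      obtain rfl : p x = s := hKp s h
      simp [h]
  have hfs : ∀ s, η ⁻¹' {some s} = K s := fun s => by ext x; simp [hsome]
  have hηf : MeasurableFibers η := by
    intro o
    have h1 : ∀ s, MeasurableSet (η ⁻¹' {some s}) := fun s => by
      rw [hfs]; exact (hKc s).measurableSet
    cases o with
    | some s => exact h1 s
    | none =>
      convert (MeasurableSet.iUnion h1).compl using 1
      ext x
      cases h : η x <;> simp [h]
  refine ⟨η, hηf, ?_, ?_⟩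
  · simp only [mapEntropy]
    rw [Fintype.sum_prod_type, Fintype.sum_option]
    have h1 : ∀ s, ∑ o, Real.negMulLog (μ ((fun x => (p x, η x)) ⁻¹' {(s, o)})).toReal ≤
        Real.negMulLog (μ (η ⁻¹' {some s})).toReal + ((Fintype.card S : ℝ) + 1)⁻¹ := by
      intro s
      rw [Fintype.sum_option, Finset.sum_eq_single s, add_comm]
      · have e1 : (fun x => (p x, η x)) ⁻¹' {(s, some s)} = η ⁻¹' {some s} := by
          ext x
          simp only [mem_preimage, mem_singleton_iff, Prod.mk.injEq, hsome, and_iff_right_iff_imp]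
          exact fun h => hKp s h
        have e2 : (fun x => (p x, η x)) ⁻¹' {(s, none)} ⊆ p ⁻¹' {s} \ K s := by
          intro x hx
          simp only [mem_preimage, mem_singleton_iff, Prod.mk.injEq] at hx
          refine ⟨hx.1, fun h => ?_⟩
          rw [(hsome x s).2 h] at hx
          simp at hx
        rw [e1]
        gcongr
        refine hδS _ ENNReal.toReal_nonneg ?_
        exact ENNReal.toReal_lt_of_lt_ofReal ((measure_mono e2).trans_lt (hKδ s))
      · intro b _ hb
        have : (fun x => (p x, η x)) ⁻¹' {(s, some b)} = ∅ := by
          ext x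
          simp only [mem_preimage, mem_singleton_iff, Prod.mk.injEq, hsome, mem_empty_iff_false,
            iff_false, not_and]
          rintro rfl h
          exact hb (hKp b h).symm
        simp [this]
      · simp
    refine (Finset.sum_le_sum fun s _ => h1 s).trans ?_
    rw [Finset.sum_add_distrib]
    have h2 : ∑ _s : S, ((Fintype.card S : ℝ) + 1)⁻¹ ≤ 1 := by
      rw [Finset.sum_const, Finset.card_univ, nsmul_eq_mul, ← div_eq_mul_inv]
      exact (div_le_one (by positivity)).2 (by linarith)
    have h3 : 0 ≤ Real.negMulLog (μ (η ⁻¹' {none})).toReal :=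
      Real.negMulLog_nonneg ENNReal.toReal_nonneg measureReal_le_one
    linarith
  · have hpair : ∀ a b, ∀ᶠ r in 𝓝[>] (0 : ℝ), a ≠ b → ∀ y ∈ K a, ∀ y' ∈ K b, r < dist y y' := by
      intro a b
      by_cases hab : a = b
      · simp [hab]
      have hd : Disjoint (K a) (K b) := Set.disjoint_left.2 fun x ha hb =>
        hab ((hKp a ha).symm.trans (hKp b hb))
      obtain ⟨r, hr, h⟩ := Metric.exists_pos_forall_lt_edist (hKc a) (hKc b).isClosed hd
      filter_upwards [Ioo_mem_nhdsGT (show (0 : ℝ) < r by exact_mod_cast hr)] with ρ hρ _ y hy y' hy'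
      have := h y hy y' hy'
      rw [edist_nndist, ENNReal.coe_lt_coe] at this
      exact hρ.2.trans (by exact_mod_cast this)
    filter_upwards [eventually_all.2 fun a => eventually_all.2 fun b => hpair a b] with
      r hr y y' a b ha hb hab
    exact hr a b hab y ((hsome _ _).1 ha) y' ((hsome _ _).1 hb)

theorem sum_comm_filter_le {W : Type*} [Fintype W] (F : Finset X) (P : X → W → Prop)
    [∀ x, DecidablePred (P x)] [∀ w, DecidablePred fun x => P x w] (g : X → ℝ) (hg : ∀ x, 0 ≤ g x)
    (N : ℕ) (hN : ∀ x, (Finset.univ.filter (P x)).card ≤ N) :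
    ∑ w, ∑ x ∈ F with P x w, g x ≤ N * ∑ x ∈ F, g x := by
  simp only [Finset.sum_filter]
  rw [Finset.sum_comm, Finset.mul_sum]
  refine Finset.sum_le_sum fun x _ => ?_
  rw [← Finset.sum_filter, Finset.sum_const, nsmul_eq_mul]
  have : ((Finset.univ.filter (P x)).card : ℝ) ≤ N := by exact_mod_cast hN x
  exact mul_le_mul_of_nonneg_right this (hg x)

theorem mapEntropy_itinerary_add_integral_le [IsProbabilityMeasure μ] {G : X → X}
    (hG : Measurable G) {η : X → Option T} (hη : MeasurableFibers η) {ε : ℝ}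
    (hsep : ∀ y y' a b, η y = some a → η y' = some b → a ≠ b → 2 * ε < dist y y')
    {n : ℕ} {F : Finset X} {R : X → X → Prop} (hcov : ∀ y, ∃ x ∈ F, R x y)
    (hR : ∀ x y, R x y → ∀ i < n, dist (G^[i] x) (G^[i] y) ≤ ε) {g : X → ℝ}
    (hgi : Integrable g μ) {c : ℝ} (hg : ∀ x y, R x y → g y ≤ g x + c) :
    mapEntropy μ (itinerary G η n) + ∫ x, g x ∂μ ≤
      Real.log (∑ x ∈ F, Real.exp (g x)) + c + n * Real.log 2 := by
  classical
  have : Nonempty X := nonempty_of_isProbabilityMeasure μ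
  set q := itinerary G η n with hqdef
  have hq : MeasurableFibers q := hη.itinerary hG n
  set P : X → (Fin n → Option T) → Prop := fun x w => ∃ y, q y = w ∧ R x y with hP
  set b : (Fin n → Option T) → ℝ := fun w => ∑ x ∈ F with P x w, Real.exp (g x) with hb
  have hb0 : ∀ w, 0 ≤ b w := fun w => Finset.sum_nonneg fun _ _ => (Real.exp_pos _).le
  have hble : ∀ y, ∃ x ∈ F, R x y ∧ Real.exp (g x) ≤ b (q y) := by
    intro y
    obtain ⟨x, hx, hxy⟩ := hcov y
    exact ⟨x, hx, hxy, Finset.single_le_sum (f := fun x => Real.exp (g x))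
      (fun _ _ => (Real.exp_pos _).le) (Finset.mem_filter.2 ⟨hx, y, rfl, hxy⟩)⟩
  have hbpos : ∀ y, 0 < b (q y) := fun y => by
    obtain ⟨x, -, -, h⟩ := hble y
    exact (Real.exp_pos _).trans_le h
  have hgb : ∀ y, g y ≤ Real.log (b (q y)) + c := by
    intro y
    obtain ⟨x, -, hxy, h⟩ := hble y
    have := (Real.le_log_iff_exp_le (hbpos y)).2 h
    linarith [hg x y hxy]
  set Z := ∑ w, b w with hZ
  have hZpos : 0 < Z := (hbpos (Classical.arbitrary X)).trans_le
    (Finset.single_le_sum (fun w _ => hb0 w) (Finset.mem_univ _))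
  have hFpos : 0 < ∑ x ∈ F, Real.exp (g x) := by
    obtain ⟨x, hx, -⟩ := hcov (Classical.arbitrary X)
    exact Finset.sum_pos (fun _ _ => Real.exp_pos _) ⟨x, hx⟩
  have hcard : ∀ x, (Finset.univ.filter (P x)).card ≤ 2 ^ n := by
    intro x
    set L : Fin n → Finset (Option T) := fun i =>
      Finset.univ.filter fun o => ∃ y, R x y ∧ η (G^[i] y) = o with hL
    have hsub : Finset.univ.filter (P x) ⊆ Fintype.piFinset L := by
      intro w hw
      obtain ⟨y, rfl, hxy⟩ := (Finset.mem_filter.1 hw).2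
      exact Fintype.mem_piFinset.2 fun i => Finset.mem_filter.2 ⟨Finset.mem_univ _, y, hxy, rfl⟩
    refine (Finset.card_le_card hsub).trans ?_
    rw [Fintype.card_piFinset]
    refine (Finset.prod_le_pow_card _ _ 2 fun i _ => ?_).trans (by simp)
    have huniq : ∀ a a', some a ∈ L i → some a' ∈ L i → a = a' := by
      intro a a' ha ha'
      obtain ⟨y, hy, hya⟩ := (Finset.mem_filter.1 ha).2
      obtain ⟨y', hy', hya'⟩ := (Finset.mem_filter.1 ha').2
      by_contra hne
      have h := hsep _ _ _ _ hya hya' hne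
      have h1 := hR x y hy i i.2
      have h2 := hR x y' hy' i i.2
      linarith [dist_triangle_left (G^[i] y) (G^[i] y') (G^[i] x)]
    by_cases h : ∃ a, some a ∈ L i
    · obtain ⟨a, ha⟩ := h
      refine (Finset.card_le_card (t := {none, some a}) fun o ho => ?_).trans Finset.card_le_two
      cases o with
      | none => simp
      | some a' => simp [huniq a' a ho ha]
    · refine (Finset.card_le_card (t := {none, none}) fun o ho => ?_).trans Finset.card_le_two
      cases o with
      | none => simp
      | some a' => exact (h ⟨a', ho⟩).elim
  have hZle : Z ≤ 2 ^ n * ∑ x ∈ F, Real.exp (g x) := by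
    simpa using sum_comm_filter_le F P (fun x => Real.exp (g x)) (fun x => (Real.exp_pos _).le)
      (2 ^ n) hcard
  have hlogZ : Real.log Z ≤ n * Real.log 2 + Real.log (∑ x ∈ F, Real.exp (g x)) := by
    refine (Real.log_le_log hZpos hZle).trans ?_
    rw [Real.log_mul (by positivity) hFpos.ne', Real.log_pow]
  obtain ⟨hi, hint⟩ := integral_comp_eq_sum_fiber (μ := μ) hq fun w => Real.log (b w)
  have h1 : ∫ x, g x ∂μ ≤ ∑ w, μ.real (q ⁻¹' {w}) * Real.log (b w) + c := by
    rw [← hint]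
    calc ∫ x, g x ∂μ ≤ ∫ x, (Real.log (b (q x)) + c) ∂μ :=
          integral_mono hgi (hi.add (integrable_const c)) hgb
      _ = _ := by rw [integral_add hi (integrable_const c)]; simp
  have hzero : ∀ w, b w = 0 → μ.real (q ⁻¹' {w}) = 0 := by
    intro w hw
    have : q ⁻¹' {w} = ∅ := by
      ext y
      simp only [mem_preimage, mem_singleton_iff, mem_empty_iff_false, iff_false]
      rintro rfl
      exact (hbpos y).ne' hw
    simp [this]
  have h2 : mapEntropy μ q ≤ ∑ w, -(μ.real (q ⁻¹' {w}) * Real.log (b w / Z)) := by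
    refine sum_negMulLog_le_of_sum_le (fun w => μ.real (q ⁻¹' {w})) (fun w => b w / Z)
      (fun _ => ENNReal.toReal_nonneg) (fun w => div_nonneg (hb0 w) hZpos.le)
      (fun w hw => hzero w ?_) ?_
    · simpa [hZpos.ne'] using hw
    · rw [sum_measureReal_fiber μ hq, ← Finset.sum_div, div_self hZpos.ne']
  have h3 : ∑ w, -(μ.real (q ⁻¹' {w}) * Real.log (b w / Z)) =
      Real.log Z - ∑ w, μ.real (q ⁻¹' {w}) * Real.log (b w) := by
    have : ∀ w, -(μ.real (q ⁻¹' {w}) * Real.log (b w / Z)) =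
        μ.real (q ⁻¹' {w}) * Real.log Z - μ.real (q ⁻¹' {w}) * Real.log (b w) := by
      intro w
      by_cases hw : b w = 0
      · simp [hzero w hw]
      · rw [Real.log_div hw hZpos.ne']; ring
    simp only [this]
    rw [Finset.sum_sub_distrib, ← Finset.sum_mul, sum_measureReal_fiber μ hq, one_mul]
  linarith

theorem integrable_of_continuous [CompactSpace X] [IsFiniteMeasure μ] {g : X → ℝ}
    (hg : Continuous g) : Integrable g μ := by
  obtain ⟨C, hC⟩ := isCompact_univ.exists_bound_of_continuousOn hg.continuousOn
  exact Integrable.of_bound hg.aestronglyMeasurable C (ae_of_all _ fun x => hC x (mem_univ x))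

theorem continuous_birkhoff (hf : Continuous f) {g : X → ℝ} (hg : Continuous g) (n : ℕ) :
    Continuous (birkhoff f g n) :=
  continuous_finsetSum _ fun i _ => hg.comp (hf.iterate i)

theorem integral_birkhoff [CompactSpace X] [IsProbabilityMeasure μ] (hf : Continuous f)
    (hμ : MeasurePreserving f μ μ) {g : X → ℝ} (hg : Continuous g) (n : ℕ) :
    ∫ x, birkhoff f g n x ∂μ = n * ∫ x, g x ∂μ := by
  simp only [birkhoff]
  rw [integral_finsetSum _ fun i _ =>
    integrable_of_continuous (g := fun x => g (f^[i] x)) (hg.comp (hf.iterate i))]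
  have : ∀ i ∈ Finset.range n, ∫ x, g (f^[i] x) ∂μ = ∫ x, g x ∂μ := fun i _ => by
    have h := hμ.iterate i
    conv_rhs => rw [← h.map_eq]
    rw [integral_map h.measurable.aemeasurable hg.aestronglyMeasurable]
  rw [Finset.sum_congr rfl this]
  simp

theorem partitionEntropy_le_of_inducedPressure_lt [CompactSpace X] [IsProbabilityMeasure μ]
    (hf : Continuous f) (hμ : MeasurePreserving f μ μ) {φ ψ : X → ℝ} (hφ : Continuous φ)
    (hψ : Continuous ψ) (hψpos : ∀ x, 0 < ψ x) {β : ℝ} (hβ : inducedPressure f ψ φ < β)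
    {p : X → S} (hp : MeasurableFibers p) :
    partitionEntropy f μ p ≤ -∫ x, (φ x - β * ψ x) ∂μ := by
  have : Nonempty X := nonempty_of_isProbabilityMeasure μ
  set g : X → ℝ := fun x => φ x - β * ψ x with hgdef
  have hg : Continuous g := hφ.sub (continuous_const.mul hψ)
  have key : ∀ N : ℕ, 0 < N → ∀ ω > 0,
      partitionEntropy f μ p ≤ (1 + Real.log 2) / N + 2 * ω - ∫ x, g x ∂μ := by
    intro N hN ω hω
    have hN' : (0 : ℝ) < N := by exact_mod_cast hN
    have hξ := hp.itinerary hf.measurable N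
    obtain ⟨η, hη, hηH, hηsep⟩ := exists_separated_approx (μ := μ) hξ
    have hdbl : Tendsto (fun ε : ℝ => 2 * ε) (𝓝[>] 0) (𝓝[>] 0) := by
      refine tendsto_nhdsWithin_iff.2 ⟨?_, ?_⟩
      · have : Tendsto (fun ε : ℝ => 2 * ε) (𝓝 0) (𝓝 (2 * 0)) := tendsto_id.const_mul 2
        rw [mul_zero] at this
        exact this.mono_left nhdsWithin_le_nhds
      · filter_upwards [self_mem_nhdsWithin] with ε hε
        exact mem_Ioi.2 (mul_pos two_pos hε)
    have hunif : ∀ᶠ ε in 𝓝[>] (0 : ℝ), ∀ x y, dist x y ≤ ε → |g x - g y| ≤ ω := by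
      obtain ⟨δ, hδ, h⟩ := Metric.uniformContinuous_iff.1
        (CompactSpace.uniformContinuous_of_continuous hg) ω hω
      filter_upwards [Ioo_mem_nhdsGT hδ] with ε hε x y hxy
      exact (h (hxy.trans_lt hε.2)).le
    obtain ⟨ε, hsep, hgε, hspan⟩ := ((hdbl.eventually hηsep).and (hunif.and
      (eventually_exists_spanning hψ hψpos hβ hω))).exists
    have hmulN : Tendsto (fun n : ℕ => n * N) atTop atTop := tendsto_id.atTop_mul_const' hN
    refine le_of_tendsto ((tendsto_partitionEntropy hμ hp).comp hmulN) ?_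
    filter_upwards [hmulN.eventually hspan, eventually_gt_atTop 0] with n ⟨F, hF, hFsum⟩ hn
    have hn' : (0 : ℝ) < n := by exact_mod_cast hn
    have hGμ := hμ.iterate N
    have h1 := mapEntropy_itinerary_mul_le (μ := μ) hf.measurable hp n N
    have h2 : mapEntropy μ (itinerary (f^[N]) (itinerary f p N) n) ≤
        mapEntropy μ (fun x => (itinerary (f^[N]) (itinerary f p N) n x,
          itinerary (f^[N]) η n x)) :=
      mapEntropy_le_of_factorsThrough μ ((hξ.itinerary hGμ.measurable n).prodMk
        (hη.itinerary hGμ.measurable n)) fun x y h => (Prod.mk.inj h).1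
    have h3 := mapEntropy_itinerary_prodMk_le hGμ hξ hη n
    have h4 : n * (mapEntropy μ (fun x => (itinerary f p N x, η x)) - mapEntropy μ η) ≤
        (n : ℝ) * 1 := by gcongr; linarith
    have h5 := mapEntropy_itinerary_add_integral_le (μ := μ) hGμ.measurable hη hsep (n := n)
      (F := F) (R := fun x y => ∀ i < n * N, dist (f^[i] x) (f^[i] y) ≤ ε)
      (fun y => hF y (mem_univ y))
      (fun x y h i hi => by
        rw [← Function.iterate_mul]
        exact h _ (by rw [mul_comm]; exact Nat.mul_lt_mul_of_pos_right hi hN))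
      (g := birkhoff f g (n * N)) (integrable_of_continuous (continuous_birkhoff hf hg _))
      (c := (n * N : ℕ) * ω)
      (fun x y h => by
        have := abs_le.1 (abs_birkhoff_sub_le (f := f) (ψ := g) (δ := ω)
          fun i hi => hgε _ _ (h i hi))
        linarith [this.1])
    rw [integral_birkhoff hf hμ hg] at h5
    have h6 : Real.log (∑ x ∈ F, Real.exp (birkhoff f g (n * N) x)) ≤ (n * N : ℕ) * ω := by
      obtain ⟨x, hx, -⟩ := hF (Classical.arbitrary X) (mem_univ _)
      exact (Real.log_le_iff_le_exp (Finset.sum_pos (fun _ _ => Real.exp_pos _) ⟨x, hx⟩)).2 hFsum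
    simp only [Function.comp_apply]
    push_cast at h5 h6 ⊢
    rw [div_le_iff₀ (by positivity)]
    have h7 : ((1 + Real.log 2) / N + 2 * ω - ∫ x, g x ∂μ) * (n * N) =
        n * (1 + Real.log 2) + 2 * (n * N * ω) - n * N * ∫ x, g x ∂μ := by
      field_simp
    rw [h7]
    linarith
  have hlim : Tendsto (fun N : ℕ => (1 + Real.log 2) / N + 2 * (1 / ((N : ℝ) + 1)) - ∫ x, g x ∂μ)
      atTop (𝓝 (0 + 2 * 0 - ∫ x, g x ∂μ)) :=
    ((tendsto_const_div_atTop_nhds_zero_nat _).add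
      (tendsto_one_div_add_atTop_nhds_zero_nat.const_mul 2)).sub_const _
  have := ge_of_tendsto hlim ((eventually_gt_atTop 0).mono fun N hN =>
    key N hN (1 / ((N : ℝ) + 1)) (by positivity))
  linarith

theorem measEntropy_le_of_inducedPressure_lt [CompactSpace X] [IsProbabilityMeasure μ]
    (hf : Continuous f) (hμ : MeasurePreserving f μ μ) {φ ψ : X → ℝ} (hφ : Continuous φ)
    (hψ : Continuous ψ) (hψpos : ∀ x, 0 < ψ x) {β : ℝ} (hβ : inducedPressure f ψ φ < β) :
    measEntropy f μ ≤ ((β * ∫ x, ψ x ∂μ - ∫ x, φ x ∂μ : ℝ) : EReal) := by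
  rw [measEntropy_le_iff hμ]
  intro k p hp
  have := partitionEntropy_le_of_inducedPressure_lt hf hμ hφ hψ hψpos hβ hp
  rw [integral_sub (integrable_of_continuous hφ)
    ((integrable_of_continuous hψ).const_mul β), integral_const_mul] at this
  exact EReal.coe_le_coe_iff.2 (by linarith)

end Variational

section ErgodicDecomposition

variable {Ω : Type*} [mΩ : MeasurableSpace Ω] {f : Ω → Ω} {μ : Measure Ω}

theorem ae_exists_tendsto_subseq_birkhoffAverage [IsProbabilityMeasure μ]
    (hf : MeasurePreserving f μ μ) {g : Ω → ℝ} (hg : MemLp g 2 μ) :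
    ∃ ns : ℕ → ℕ, StrictMono ns ∧ ∀ᵐ x ∂μ, ∃ l,
      Tendsto (fun k => birkhoffAverage ℝ f g (ns k) x) atTop (𝓝 l) := by
  set U : Lp ℝ 2 μ →L[ℝ] Lp ℝ 2 μ :=
    (Lp.compMeasurePreservingₗᵢ ℝ f hf).toContinuousLinearMap with hU
  have hgi : ∀ i, MemLp (g ∘ f^[i]) 2 μ := fun i => hg.comp_measurePreserving (hf.iterate i)
  have hiter : ∀ i, U^[i] (hg.toLp g) = (hgi i).toLp _ := by
    intro i
    induction i with
    | zero => rfl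
    | succ i ih => rw [Function.iterate_succ_apply', ih]; rfl
  have hae : ∀ n, (birkhoffAverage ℝ U _root_.id n (hg.toLp g) : Lp ℝ 2 μ) =ᵐ[μ]
      birkhoffAverage ℝ f g n := by
    intro n
    have h1 : birkhoffAverage ℝ U _root_.id n (hg.toLp g) =
        (n : ℝ)⁻¹ • ∑ i ∈ Finset.range n, (hgi i).toLp _ := by
      simp [birkhoffAverage, birkhoffSum, hiter]
    rw [h1]
    have h2 : ∀ᵐ x ∂μ, ∀ i, (hgi i).toLp _ x = g (f^[i] x) :=
      ae_all_iff.2 fun i => (hgi i).coeFn_toLp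
    filter_upwards [h2, Lp.coeFn_smul (n : ℝ)⁻¹ (∑ i ∈ Finset.range n, (hgi i).toLp _),
      Lp.coeFn_finsetSum (Finset.range n) fun i => (hgi i).toLp _] with x hx h3 h4
    rw [h3, Pi.smul_apply, h4]
    simp [birkhoffAverage, birkhoffSum, hx]
  have hlim := U.tendsto_birkhoffAverage_orthogonalProjection
    (LinearIsometry.norm_toContinuousLinearMap_le _) (hg.toLp g)
  obtain ⟨ns, hns, h⟩ := (tendstoInMeasure_of_tendsto_Lp hlim).exists_seq_tendsto_ae
  refine ⟨ns, hns, ?_⟩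
  filter_upwards [h, ae_all_iff.2 hae] with x hx hx'
  exact ⟨_, hx.congr fun k => hx' (ns k)⟩

theorem limUnder_congr_of_tendsto_sub {u v : ℕ → ℝ}
    (h : Tendsto (fun k => u k - v k) atTop (𝓝 0)) : limUnder atTop u = limUnder atTop v := by
  have : ∀ l, Tendsto u atTop (𝓝 l) ↔ Tendsto v atTop (𝓝 l) := fun l =>
    ⟨fun hu => by simpa using hu.sub h, fun hv => by simpa using hv.add h⟩
  unfold limUnder lim
  congr 1
  ext l
  exact this l

theorem exists_invariant_limit_birkhoffAverage [IsProbabilityMeasure μ]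
    (hf : MeasurePreserving f μ μ) {C : Set Ω} (hC : MeasurableSet C) :
    ∃ (ns : ℕ → ℕ) (G : Ω → ℝ), Measurable[MeasurableSpace.invariants f] G ∧
      (∀ k, ns k = 0 → k = 0) ∧
      ∀ᵐ x ∂μ, Tendsto (fun k => birkhoffAverage ℝ f (C.indicator 1) (ns k) x) atTop
        (𝓝 (G x)) := by
  have hg : Measurable (C.indicator (1 : Ω → ℝ)) := measurable_one.indicator hC
  have hmem : MemLp (C.indicator (1 : Ω → ℝ)) 2 μ :=
    MemLp.of_bound hg.aestronglyMeasurable 1 (ae_of_all _ fun x => by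
      by_cases hx : x ∈ C <;> simp [hx])
  obtain ⟨ns, hns, h⟩ := ae_exists_tendsto_subseq_birkhoffAverage hf hmem
  set G : Ω → ℝ := fun x => limUnder atTop fun k =>
    birkhoffAverage ℝ f (C.indicator (1 : Ω → ℝ)) (ns k) x with hG
  have hAm : ∀ n, Measurable (birkhoffAverage ℝ f (C.indicator (1 : Ω → ℝ)) n) := fun n => by
    unfold birkhoffAverage birkhoffSum
    have := Finset.measurable_sum (Finset.range n) fun i _ => hg.comp (hf.measurable.iterate i)
    exact this.const_smul (n : ℝ)⁻¹
  have hGm : Measurable G :=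
    (StronglyMeasurable.limUnder fun k => (hAm (ns k)).stronglyMeasurable).measurable
  have hGf : G ∘ f = G := by
    ext x
    refine limUnder_congr_of_tendsto_sub ?_
    have hb : Bornology.IsBounded (range fun n => C.indicator (1 : Ω → ℝ) (f^[n] x)) := by
      refine (Metric.isBounded_Icc (0 : ℝ) 1).subset ?_
      rintro _ ⟨n, rfl⟩
      by_cases hx : f^[n] x ∈ C <;> simp [hx]
    exact (tendsto_birkhoffAverage_apply_sub_birkhoffAverage ℝ hb).comp hns.tendsto_atTop
  refine ⟨ns, G, ?_, fun k hk => Nat.le_zero.1 (hk ▸ hns.id_le k), ?_⟩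
  · rw [MeasurableSpace.measurable_invariants_dom]
    exact ⟨hGm, fun s _ => by rw [hGf]⟩
  · filter_upwards [h] with x ⟨l, hl⟩
    exact tendsto_nhds_limUnder ⟨l, hl⟩

theorem exists_countable_isPiSystem_generateFrom (Ω : Type*) [mΩ : MeasurableSpace Ω]
    [MeasurableSpace.CountablyGenerated Ω] :
    ∃ b : Set (Set Ω), b.Countable ∧ mΩ = MeasurableSpace.generateFrom b ∧ IsPiSystem b ∧
      ∀ s ∈ b, MeasurableSet s := by
  obtain ⟨c, hc, hce⟩ := MeasurableSpace.CountablyGenerated.isCountablyGenerated (α := Ω)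
  have hb : mΩ = MeasurableSpace.generateFrom (generateSetAlgebra c) := by
    rw [generateFrom_generateSetAlgebra_eq, hce]
  refine ⟨generateSetAlgebra c, countable_generateSetAlgebra hc, hb,
    fun s hs t ht _ => isSetAlgebra_generateSetAlgebra.inter_mem hs ht, fun s hs => ?_⟩
  rw [hb]
  exact MeasurableSpace.measurableSet_generateFrom hs

variable [StandardBorelSpace Ω]

open ProbabilityTheory

/-- The conditional measures of `μ` given the `σ`-algebra of `f`-invariant sets. -/
noncomputable def ergodicComponent (f : Ω → Ω) (μ : Measure Ω) [IsFiniteMeasure μ] (x : Ω) :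
    Measure Ω := condExpKernel μ (MeasurableSpace.invariants f) x

instance [IsFiniteMeasure μ] (x : Ω) : IsProbabilityMeasure (ergodicComponent f μ x) := by
  unfold ergodicComponent; infer_instance

theorem ae_ae_ergodicComponent [IsFiniteMeasure μ] {P : Ω → Prop} (h : ∀ᵐ x ∂μ, P x) :
    ∀ᵐ x ∂μ, ∀ᵐ y ∂(ergodicComponent f μ x), P y := by
  have hm := MeasurableSpace.invariants_le f
  rw [← condExpKernel_comp_trim (μ := μ) hm] at h
  exact ae_of_ae_trim hm (Measure.ae_ae_of_ae_comp h)

theorem ae_ae_eq_of_measurable_invariants [IsFiniteMeasure μ] {G : Ω → ℝ}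
    (hG : Measurable[MeasurableSpace.invariants f] G) :
    ∀ᵐ x ∂μ, ∀ᵐ y ∂(ergodicComponent f μ x), G y = G x := by
  have hm := MeasurableSpace.invariants_le f
  have h : ∀ᵐ z ∂((μ.trim hm) ⊗ₘ condExpKernel μ (MeasurableSpace.invariants f)),
      G z.2 = G z.1 := by
    rw [compProd_trim_condExpKernel]
    have hset : MeasurableSet[(MeasurableSpace.invariants f).prod mΩ]
        {z : Ω × Ω | G z.2 = G z.1} :=
      @measurableSet_eq_fun _ _ ((MeasurableSpace.invariants f).prod mΩ) _ _ _ _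
        ((hG.mono hm le_rfl).comp (@measurable_snd _ _ (MeasurableSpace.invariants f) mΩ))
        (hG.comp (@measurable_fst _ _ (MeasurableSpace.invariants f) mΩ))
    have hdiag : @Measurable Ω (Ω × Ω) mΩ ((MeasurableSpace.invariants f).prod mΩ)
        Function.diag :=
      @Measurable.prodMk _ mΩ _ _ (MeasurableSpace.invariants f) mΩ _ _
        (measurable_id'' hm) measurable_id
    rw [@ae_map_iff _ _ mΩ ((MeasurableSpace.invariants f).prod mΩ) _ _
      (@Measurable.aemeasurable _ _ mΩ ((MeasurableSpace.invariants f).prod mΩ) _ _ hdiag) _ hset]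
    exact ae_of_all _ fun _ => rfl
  exact ae_of_ae_trim hm (Measure.ae_ae_of_ae_compProd h)

theorem measurable_ergodicComponent [IsFiniteMeasure μ] {s : Set Ω} (hs : MeasurableSet s) :
    Measurable[MeasurableSpace.invariants f] fun x => ergodicComponent f μ x s :=
  measurable_condExpKernel hs

theorem setLIntegral_ergodicComponent [IsFiniteMeasure μ] {A s : Set Ω}
    (hA : MeasurableSet[MeasurableSpace.invariants f] A) (hs : MeasurableSet s) :
    ∫⁻ x in A, ergodicComponent f μ x s ∂μ = μ (A ∩ s) := by
  have hm := MeasurableSpace.invariants_le f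
  have h1 : ∀ᵐ x ∂μ, (ergodicComponent f μ x).real s = (μ⟦s|MeasurableSpace.invariants f⟧) x :=
    condExpKernel_ae_eq_condExp hm hs
  have h2 : ∫ x in A, (ergodicComponent f μ x).real s ∂μ = μ.real (A ∩ s) := by
    rw [setIntegral_congr_ae (g := (μ⟦s|MeasurableSpace.invariants f⟧)) (hm _ hA)
      (h1.mono fun x hx _ => hx), setIntegral_condExp hm _ hA]
    · rw [setIntegral_indicator hs]
      simp
    · exact (integrable_const _).indicator hs
  have h3 : Measurable fun x => ergodicComponent f μ x s :=
    (measurable_ergodicComponent hs).mono hm le_rfl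
  simp only [Measure.real] at h2
  rw [integral_toReal h3.aemeasurable (ae_of_all _ fun x => measure_lt_top _ _)] at h2
  refine (ENNReal.toReal_eq_toReal_iff' ?_ (by finiteness)).1 h2
  refine ((lintegral_mono fun x => prob_le_one).trans_lt ?_).ne
  simp

theorem ae_measurePreserving_ergodicComponent [IsFiniteMeasure μ]
    (hf : MeasurePreserving f μ μ) :
    ∀ᵐ x ∂μ, MeasurePreserving f (ergodicComponent f μ x) (ergodicComponent f μ x) := by
  have hm := MeasurableSpace.invariants_le f
  obtain ⟨b, hbc, hbe, hbpi, hbm⟩ := exists_countable_isPiSystem_generateFrom Ω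
  have key : ∀ s ∈ b, ∀ᵐ x ∂μ, ergodicComponent f μ x (f ⁻¹' s) = ergodicComponent f μ x s := by
    intro s hs
    have hs' := hbm s hs
    have hfs := hf.measurable hs'
    refine ae_of_ae_trim hm (ae_eq_of_forall_setLIntegral_eq_of_sigmaFinite
      (measurable_ergodicComponent hfs) (measurable_ergodicComponent hs') fun A hA _ => ?_)
    rw [setLIntegral_trim hm (measurable_ergodicComponent hfs) hA,
      setLIntegral_trim hm (measurable_ergodicComponent hs') hA,
      setLIntegral_ergodicComponent hA hfs, setLIntegral_ergodicComponent hA hs',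
      ← hf.measure_preimage ((hm _ hA).inter hs').nullMeasurableSet, preimage_inter, hA.2]
  filter_upwards [(ae_ball_iff hbc).2 key] with x hx
  refine ⟨hf.measurable, ?_⟩
  have := Measure.isProbabilityMeasure_map (μ := ergodicComponent f μ x) hf.measurable.aemeasurable
  refine ext_of_generate_finite b hbe hbpi (fun s hs => ?_) (by simp)
  rw [Measure.map_apply hf.measurable (hbm s hs), hx s hs]

theorem ae_ergodic_ergodicComponent [IsProbabilityMeasure μ] (hf : MeasurePreserving f μ μ) :
    ∀ᵐ x ∂μ, Ergodic f (ergodicComponent f μ x) := by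
  have hm := MeasurableSpace.invariants_le f
  obtain ⟨b, hbc, hbe, hbpi, hbm⟩ := exists_countable_isPiSystem_generateFrom Ω
  have key : ∀ C ∈ b, ∀ᵐ x ∂μ, ∃ (ns : ℕ → ℕ) (c : ℝ), (∀ k, ns k = 0 → k = 0) ∧
      ∀ᵐ y ∂(ergodicComponent f μ x),
        Tendsto (fun k => birkhoffAverage ℝ f (C.indicator 1) (ns k) y) atTop (𝓝 c) := by
    intro C hC
    obtain ⟨ns, G, hG, hns, h⟩ := exists_invariant_limit_birkhoffAverage hf (hbm C hC)
    filter_upwards [ae_ae_ergodicComponent (f := f) h,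
      ae_ae_eq_of_measurable_invariants (μ := μ) hG] with x h1 h2
    refine ⟨ns, G x, hns, ?_⟩
    filter_upwards [h1, h2] with y h1 h2
    rwa [← h2]
  filter_upwards [(ae_ball_iff hbc).2 key, ae_measurePreserving_ergodicComponent hf] with x hx hinv
  set ν := ergodicComponent f μ x
  refine ⟨hinv, ⟨fun B hB hfB => ?_⟩⟩
  have hint : ∀ C ∈ b, ∃ c : ℝ, ∀ A, MeasurableSet A → f ⁻¹' A = A →
      ν.real (C ∩ A) = c * ν.real A := by
    intro C hC
    obtain ⟨ns, c, hns, hc⟩ := hx C hC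
    refine ⟨c, fun A hA hfA => ?_⟩
    have hg : Measurable (C.indicator (1 : Ω → ℝ)) := measurable_one.indicator (hbm C hC)
    have hfi : ∀ i, f^[i] ⁻¹' A = A := fun i => by
      rw [preimage_iterate_eq]; exact Function.iterate_fixed hfA i
    have hterm : ∀ i, Integrable (fun y => C.indicator (1 : Ω → ℝ) (f^[i] y)) (ν.restrict A) ∧
        ∫ y in A, C.indicator (1 : Ω → ℝ) (f^[i] y) ∂ν = ν.real (C ∩ A) := by
      intro i
      have e : (fun y => C.indicator (1 : Ω → ℝ) (f^[i] y)) =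
          (f^[i] ⁻¹' C).indicator 1 := by
        rfl
      have hCi : MeasurableSet (f^[i] ⁻¹' C) := hinv.measurable.iterate i (hbm C hC)
      rw [e]
      refine ⟨(integrable_const (1 : ℝ)).indicator hCi, ?_⟩
      rw [integral_indicator_one hCi, measureReal_restrict_apply hCi]
      nth_rewrite 1 [← hfi i]
      rw [← preimage_inter, measureReal_def, (hinv.iterate i).measure_preimage
        ((hbm C hC).inter hA).nullMeasurableSet, measureReal_def]
    have havg : ∀ k, k ≠ 0 → ∫ y in A, birkhoffAverage ℝ f (C.indicator (1 : Ω → ℝ)) (ns k) y ∂ν =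
        ν.real (C ∩ A) := by
      intro k hk
      have hn : (ns k : ℝ) ≠ 0 := by
        intro h
        exact hk (hns k (by exact_mod_cast h))
      simp only [birkhoffAverage, birkhoffSum, smul_eq_mul]
      rw [integral_const_mul, integral_finsetSum _ fun i _ => (hterm i).1]
      simp only [(hterm _).2]
      simp [hn]
    have hlim : Tendsto (fun k => ∫ y in A, birkhoffAverage ℝ f (C.indicator (1 : Ω → ℝ)) (ns k) y ∂ν)
        atTop (𝓝 (∫ _y in A, c ∂ν)) := by
      refine tendsto_integral_of_dominated_convergence (fun _ => 1) (fun k => ?_)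
        (integrable_const _) (fun k => ae_of_all _ fun y => ?_) (ae_restrict_of_ae hc)
      · unfold birkhoffAverage birkhoffSum
        have := Finset.measurable_sum (Finset.range (ns k)) fun i _ =>
          hg.comp (hinv.measurable.iterate i)
        exact (this.const_smul (ns k : ℝ)⁻¹).aestronglyMeasurable
      · have h1 : ∀ z, ‖C.indicator (1 : Ω → ℝ) z‖ ≤ 1 := fun z => by
          by_cases hz : z ∈ C <;> simp [hz]
        simp only [birkhoffAverage, birkhoffSum, smul_eq_mul, norm_mul]
        have h2 : ‖∑ i ∈ Finset.range (ns k), C.indicator (1 : Ω → ℝ) (f^[i] y)‖ ≤ ns k := by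
          simpa using norm_sum_le_of_le (Finset.range (ns k)) fun i _ => h1 (f^[i] y)
        calc _ ≤ ‖(ns k : ℝ)⁻¹‖ * ns k := by gcongr
          _ ≤ 1 := by
            rw [norm_inv, Real.norm_natCast]
            exact inv_mul_le_one
    have hconst : Tendsto (fun k => ∫ y in A,
        birkhoffAverage ℝ f (C.indicator (1 : Ω → ℝ)) (ns k) y ∂ν) atTop (𝓝 (ν.real (C ∩ A))) :=
      tendsto_const_nhds.congr' ((eventually_ne_atTop 0).mono fun k hk => (havg k hk).symm)
    rw [tendsto_nhds_unique hconst hlim]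
    simp [mul_comm]
  have hmul : ∀ C ∈ b, ν (C ∩ B) = ν B * ν C := by
    intro C hC
    obtain ⟨c, hc⟩ := hint C hC
    have h1 := hc univ MeasurableSet.univ rfl
    have h2 := hc B hB hfB
    simp only [inter_univ, probReal_univ, mul_one] at h1
    rw [← h1] at h2
    rw [← ENNReal.toReal_eq_toReal_iff' (by finiteness) (by finiteness), ENNReal.toReal_mul]
    simpa [Measure.real, mul_comm] using h2
  have hres : ν.restrict B = ν B • ν := by
    refine ext_of_generate_finite b hbe hbpi (fun C hC => ?_) (by simp)
    rw [Measure.restrict_apply (hbm C hC), hmul C hC]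
    simp
  have hBB : ν B = ν B * ν B := by
    have := congrArg (fun ρ : Measure Ω => ρ B) hres
    simpa using this
  rw [eventuallyConst_set']
  have : ν.real B = 0 ∨ ν.real B = 1 := by
    have h : ν.real B = ν.real B * ν.real B := by
      simp only [Measure.real, ← ENNReal.toReal_mul, ← hBB]
    rcases eq_or_ne (ν.real B) 0 with h0 | h0
    · exact Or.inl h0
    · exact Or.inr (mul_left_cancel₀ h0 (by rw [← h, mul_one]))
  rcases this with h | h
  · left
    exact ae_eq_empty.2 ((measureReal_eq_zero_iff).1 h)
  · right
    rw [ae_eq_univ, prob_compl_eq_zero_iff hB]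
    rwa [measureReal_def, ENNReal.toReal_eq_one_iff] at h

theorem integral_integral_ergodicComponent [IsFiniteMeasure μ] {g : Ω → ℝ} (hg : Integrable g μ) :
    Integrable (fun x => ∫ y, g y ∂(ergodicComponent f μ x)) μ ∧
      ∫ x, ∫ y, g y ∂(ergodicComponent f μ x) ∂μ = ∫ x, g x ∂μ := by
  have hm := MeasurableSpace.invariants_le f
  refine ⟨hg.integral_condExpKernel, ?_⟩
  rw [← integral_condExp hm (f := g)]
  exact integral_congr_ae (condExp_ae_eq_integral_condExpKernel hm hg).symm

end ErgodicDecomposition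

section EntropyDecomposition

variable {X : Type*} [MetricSpace X] [MeasurableSpace X] [BorelSpace X]
variable {S T : Type*} [Fintype S] [Fintype T] {f : X → X} {μ : Measure X}

theorem partitionEntropy_le_of_invariant [IsProbabilityMeasure μ] (hf : MeasurePreserving f μ μ)
    {p : X → S} (hp : MeasurableFibers p) {β : X → T} (hβ : MeasurableFibers β)
    (hβf : ∀ x, β (f x) = β x) {k : ℕ} (hk : 0 < k) :
    partitionEntropy f μ p ≤
      (mapEntropy μ (fun x => (itinerary f p k x, β x)) - mapEntropy μ β) / k := by
  have hk' : (0 : ℝ) < k := by exact_mod_cast hk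
  set q := itinerary f p k
  have hq : MeasurableFibers q := hp.itinerary hf.measurable k
  set D := mapEntropy μ (fun x => (q x, β x)) - mapEntropy μ β
  have hmul : Tendsto (fun n : ℕ => n * k) atTop atTop := tendsto_id.atTop_mul_const' hk
  have hlim : Tendsto (fun n : ℕ => mapEntropy μ β / k / n + D / k) atTop (𝓝 (0 + D / k)) :=
    (tendsto_const_div_atTop_nhds_zero_nat _).add_const _
  rw [zero_add] at hlim
  refine le_of_tendsto_of_tendsto ((tendsto_partitionEntropy hf hp).comp hmul) hlim ?_
  filter_upwards [eventually_gt_atTop 0] with n hn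
  have hn' : (0 : ℝ) < n := by exact_mod_cast hn
  have hGμ := hf.iterate k
  have hβi : ∀ i x, β ((f^[k])^[i] x) = β x := by
    intro i x
    rw [← Function.iterate_mul]
    induction k * i with
    | zero => rfl
    | succ m ih => rw [Function.iterate_succ_apply', hβf, ih]
  have h1 := mapEntropy_itinerary_mul_le (μ := μ) hf.measurable hp n k
  have h2 : mapEntropy μ (itinerary (f^[k]) q n) ≤
      mapEntropy μ (fun x => (itinerary (f^[k]) q n x, itinerary (f^[k]) β n x)) :=
    mapEntropy_le_of_factorsThrough μ ((hq.itinerary hGμ.measurable n).prodMk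
      (hβ.itinerary hGμ.measurable n)) fun x y h => (Prod.mk.inj h).1
  have h3 := mapEntropy_itinerary_prodMk_le hGμ hq hβ n
  have h4 : mapEntropy μ (itinerary (f^[k]) β n) ≤ mapEntropy μ β :=
    mapEntropy_le_of_factorsThrough μ hβ fun x y h => by
      rw [itinerary_eq_iff]
      intro i _
      rw [hβi, hβi, h]
  simp only [Function.comp_apply]
  push_cast
  rw [div_le_iff₀ (by positivity)]
  have h5 : (mapEntropy μ β / k / n + D / k) * (n * k) = mapEntropy μ β + n * D := by
    field_simp
  rw [h5]
  linarith

theorem negMulLog_setIntegral_le [IsFiniteMeasure μ] {B : Set X} (hB : MeasurableSet B) {g : X → ℝ}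
    (hg : Measurable g) (hg0 : ∀ x, 0 ≤ g x) (hg1 : ∀ x, g x ≤ 1) {δ ε : ℝ}
    (hδ : ∀ x ∈ B, ∀ y ∈ B, |g x - g y| ≤ δ)
    (hε : ∀ s ∈ Icc (0 : ℝ) 1, ∀ t ∈ Icc (0 : ℝ) 1, |s - t| ≤ δ →
      Real.negMulLog s ≤ Real.negMulLog t + ε) :
    Real.negMulLog (∫ x in B, g x ∂μ) ≤ ∫ x in B, Real.negMulLog (g x) ∂μ + ε * μ.real B +
      (∫ x in B, g x ∂μ) / μ.real B * Real.negMulLog (μ.real B) := by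
  have hgi : Integrable g (μ.restrict B) :=
    Integrable.of_bound hg.aestronglyMeasurable 1 (ae_of_all _ fun x => by
      rw [Real.norm_of_nonneg (hg0 x)]; exact hg1 x)
  have hni : Integrable (fun x => Real.negMulLog (g x)) (μ.restrict B) :=
    Integrable.of_bound (Real.continuous_negMulLog.measurable.comp hg).aestronglyMeasurable 1
      (ae_of_all _ fun x => by
        rw [Real.norm_of_nonneg (Real.negMulLog_nonneg (hg0 x) (hg1 x))]
        linarith [Real.negMulLog_le_one_sub_self (hg0 x), hg0 x])
  rcases eq_or_ne (μ B) 0 with h0 | h0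
  · simp [Measure.restrict_eq_zero.2 h0, measureReal_def, h0]
  set A := μ.real B
  have hA : 0 < A := ENNReal.toReal_pos h0 (by finiteness)
  set I := ∫ x in B, g x ∂μ
  have hI0 : 0 ≤ I := integral_nonneg hg0
  have hconst : ∀ c : ℝ, ∫ _x in B, c ∂μ = c * A := fun c => by simp [A, mul_comm]
  have hI1 : I ≤ A := by
    rw [← one_mul A, ← hconst]
    exact integral_mono hgi (integrable_const _) hg1
  have hmem : I / A ∈ Icc (0 : ℝ) 1 := ⟨by positivity, (div_le_one hA).2 hI1⟩
  have hclose : ∀ x ∈ B, |I / A - g x| ≤ δ := by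
    intro x hx
    have h1 : I ≤ (g x + δ) * A := by
      rw [← hconst]
      exact setIntegral_mono_on hgi (integrable_const _) hB fun y hy => by
        linarith [(abs_le.1 (hδ x hx y hy)).1]
    have h2 : (g x - δ) * A ≤ I := by
      rw [← hconst]
      exact setIntegral_mono_on (integrable_const _) hgi hB fun y hy => by
        linarith [(abs_le.1 (hδ x hx y hy)).2]
    rw [abs_le]
    constructor
    · linarith [(le_div_iff₀ hA).2 h2]
    · linarith [(div_le_iff₀ hA).2 h1]
  have h1 : Real.negMulLog (I / A) * A ≤ ∫ x in B, Real.negMulLog (g x) ∂μ + ε * A := by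
    rw [← hconst, ← hconst, ← integral_add hni (integrable_const _)]
    exact setIntegral_mono_on (integrable_const _) (hni.add (integrable_const _)) hB fun x hx =>
      hε _ hmem _ ⟨hg0 x, hg1 x⟩ (hclose x hx)
  have h2 : Real.negMulLog I = Real.negMulLog (I / A) * A + I / A * Real.negMulLog A := by
    conv_lhs => rw [← div_mul_cancel₀ I hA.ne', Real.negMulLog_mul]
    ring
  linarith

theorem exists_modulus_negMulLog {ε : ℝ} (hε : 0 < ε) : ∃ δ > 0, ∀ s ∈ Icc (0 : ℝ) 1,
    ∀ t ∈ Icc (0 : ℝ) 1, |s - t| ≤ δ → Real.negMulLog s ≤ Real.negMulLog t + ε := by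
  have h := isCompact_Icc.uniformContinuousOn_of_continuous
    (Real.continuous_negMulLog.continuousOn (s := Icc (0 : ℝ) 1))
  obtain ⟨δ, hδ, h⟩ := Metric.uniformContinuousOn_iff.1 h ε hε
  refine ⟨δ / 2, by positivity, fun s hs t ht hst => ?_⟩
  have := h s hs t ht (by rw [Real.dist_eq]; linarith)
  rw [Real.dist_eq] at this
  linarith [(abs_lt.1 this).2]

variable [CompactSpace X]

theorem measurable_real_ergodicComponent [IsFiniteMeasure μ] {s : Set X} (hs : MeasurableSet s) :
    Measurable[MeasurableSpace.invariants f] fun x => (ergodicComponent f μ x).real s :=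
  (measurable_ergodicComponent hs).ennreal_toReal

theorem setIntegral_real_ergodicComponent [IsFiniteMeasure μ] {A s : Set X}
    (hA : MeasurableSet[MeasurableSpace.invariants f] A) (hs : MeasurableSet s) :
    ∫ x in A, (ergodicComponent f μ x).real s ∂μ = μ.real (A ∩ s) := by
  simp only [measureReal_def]
  rw [integral_toReal (((measurable_ergodicComponent hs).mono (MeasurableSpace.invariants_le f)
    le_rfl).aemeasurable) (ae_of_all _ fun x => measure_lt_top _ _),
    setLIntegral_ergodicComponent hA hs]

theorem measurable_mapEntropy_ergodicComponent [IsFiniteMeasure μ] {q : X → S}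
    (hq : MeasurableFibers q) : Measurable fun x => mapEntropy (ergodicComponent f μ x) q :=
  Finset.measurable_sum _ fun s _ => Real.continuous_negMulLog.measurable.comp
    ((measurable_real_ergodicComponent (f := f) (hq s)).mono (MeasurableSpace.invariants_le f)
      le_rfl)

theorem exists_invariant_approx [DecidableEq S] [IsProbabilityMeasure μ] {q : X → S}
    (hq : MeasurableFibers q) {ε : ℝ} (hε : 0 < ε) :
    ∃ (M : ℕ) (β : X → S → Fin (M + 1)), MeasurableFibers β ∧ (∀ x, β (f x) = β x) ∧
      mapEntropy μ (fun x => (q x, β x)) - mapEntropy μ β ≤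
        ∫ x, mapEntropy (ergodicComponent f μ x) q ∂μ + ε := by
  have hm := MeasurableSpace.invariants_le f
  obtain ⟨δ, hδ, hmod⟩ := exists_modulus_negMulLog
    (show 0 < ε / (Fintype.card S + 1) by positivity)
  obtain ⟨M, hM⟩ := exists_nat_one_div_lt hδ
  set g : S → X → ℝ := fun w x => (ergodicComponent f μ x).real (q ⁻¹' {w}) with hg
  have hgm : ∀ w, Measurable[MeasurableSpace.invariants f] (g w) := fun w =>
    measurable_real_ergodicComponent (hq w)
  have hg0 : ∀ w x, 0 ≤ g w x := fun w x => measureReal_nonneg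
  have hg1 : ∀ w x, g w x ≤ 1 := fun w x => measureReal_le_one
  set β : X → S → Fin (M + 1 + 1) := fun x w => ⟨⌊((M + 1 : ℕ) : ℝ) * g w x⌋₊, by
    rw [Nat.lt_succ_iff]
    refine Nat.floor_le_of_le ?_
    exact mul_le_of_le_one_right (by positivity) (hg1 w x)⟩ with hβdef
  have hβm : ∀ b, MeasurableSet[MeasurableSpace.invariants f] (β ⁻¹' {b}) := by
    intro b
    have : β ⁻¹' {b} = ⋂ w, (fun x => ⌊((M + 1 : ℕ) : ℝ) * g w x⌋₊) ⁻¹' {(b w : ℕ)} := by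
      ext x
      simp [hβdef, funext_iff, Fin.ext_iff]
    rw [this]
    refine @MeasurableSet.iInter _ _ (MeasurableSpace.invariants f) _ _ fun w => ?_
    exact (Nat.measurable_floor.comp ((hgm w).const_mul _)) (measurableSet_singleton _)
  have hβ : MeasurableFibers β := fun b => hm _ (hβm b)
  have hgf : ∀ w x, g w (f x) = g w x := fun w x =>
    congrFun (MeasurableSpace.comp_eq_of_measurable_invariants (hgm w)) x
  refine ⟨M + 1, β, hβ, fun x => ?_, ?_⟩
  · ext w
    simp only [hβdef, hgf]
  have hclose : ∀ b w, ∀ x ∈ β ⁻¹' {b}, ∀ y ∈ β ⁻¹' {b}, |g w x - g w y| ≤ δ := by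
    intro b w x hx y hy
    have hxy : ⌊((M + 1 : ℕ) : ℝ) * g w x⌋₊ = ⌊((M + 1 : ℕ) : ℝ) * g w y⌋₊ := by
      have : β x = β y := hx.trans hy.symm
      exact Fin.ext_iff.1 (congrFun this w)
    have hpos : (0 : ℝ) < (M + 1 : ℕ) := by positivity
    have x1 := Nat.floor_le (mul_nonneg hpos.le (hg0 w x))
    have x2 := Nat.lt_floor_add_one (((M + 1 : ℕ) : ℝ) * g w x)
    have y1 := Nat.floor_le (mul_nonneg hpos.le (hg0 w y))
    have y2 := Nat.lt_floor_add_one (((M + 1 : ℕ) : ℝ) * g w y)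
    rw [hxy] at x1 x2
    have h : ((M + 1 : ℕ) : ℝ) * |g w x - g w y| ≤ 1 := by
      rw [show ((M + 1 : ℕ) : ℝ) * |g w x - g w y| = |((M + 1 : ℕ) : ℝ) * (g w x - g w y)| by
        rw [abs_mul, abs_of_pos hpos], mul_sub, abs_le]
      constructor <;> linarith
    have h' : |g w x - g w y| ≤ 1 / ((M : ℝ) + 1) := by
      rw [le_div_iff₀ (by positivity)]
      push_cast at h
      linarith
    linarith
  have hint : ∀ b w, ∫ x in β ⁻¹' {b}, g w x ∂μ = μ.real ((fun x => (q x, β x)) ⁻¹' {(w, b)}) := by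
    intro b w
    rw [setIntegral_real_ergodicComponent (hβm b) (hq w)]
    congr 1
    ext x
    simp [and_comm]
  have hstep : ∀ b w, Real.negMulLog (μ.real ((fun x => (q x, β x)) ⁻¹' {(w, b)})) ≤
      ∫ x in β ⁻¹' {b}, Real.negMulLog (g w x) ∂μ +
        ε / (Fintype.card S + 1) * μ.real (β ⁻¹' {b}) +
        μ.real ((fun x => (q x, β x)) ⁻¹' {(w, b)}) / μ.real (β ⁻¹' {b}) *
          Real.negMulLog (μ.real (β ⁻¹' {b})) := by
    intro b w
    rw [← hint]
    exact negMulLog_setIntegral_le (hβ b) ((hgm w).mono hm le_rfl) (hg0 w) (hg1 w) (hclose b w)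
      hmod
  have hsumw : ∀ b, ∑ w, μ.real ((fun x => (q x, β x)) ⁻¹' {(w, b)}) = μ.real (β ⁻¹' {b}) := by
    intro b
    have := sum_measureReal_fiber_mul_comp μ (hq.prodMk hβ) Prod.snd (fun b' => if b' = b then 1 else 0)
    simp only [Fintype.sum_prod_type, mul_ite, mul_one, mul_zero, Finset.sum_ite_eq',
      Finset.mem_univ, if_true] at this
    exact this
  have hni : ∀ w, Integrable (fun x => Real.negMulLog (g w x)) μ := fun w =>
    Integrable.of_bound (Real.continuous_negMulLog.measurable.comp
      ((hgm w).mono hm le_rfl)).aestronglyMeasurable 1 (ae_of_all _ fun x => by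
        rw [Real.norm_of_nonneg (Real.negMulLog_nonneg (hg0 w x) (hg1 w x))]
        linarith [Real.negMulLog_le_one_sub_self (hg0 w x), hg0 w x])
  have hsplit : ∀ w, ∑ b, ∫ x in β ⁻¹' {b}, Real.negMulLog (g w x) ∂μ =
      ∫ x, Real.negMulLog (g w x) ∂μ := by
    intro w
    rw [← integral_iUnion_fintype hβ (fun b b' hbb' => ?_) fun b => (hni w).integrableOn]
    · rw [← preimage_iUnion, iUnion_of_singleton, preimage_univ, setIntegral_univ]
    · exact Disjoint.preimage _ (disjoint_singleton.2 hbb')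
  have hH : ∫ x, mapEntropy (ergodicComponent f μ x) q ∂μ =
      ∑ w, ∫ x, Real.negMulLog (g w x) ∂μ := by
    simp only [mapEntropy]
    exact integral_finsetSum _ fun w _ => hni w
  have h1 : mapEntropy μ (fun x => (q x, β x)) ≤ ∑ b, ∑ w,
      (∫ x in β ⁻¹' {b}, Real.negMulLog (g w x) ∂μ +
        ε / (Fintype.card S + 1) * μ.real (β ⁻¹' {b}) +
        μ.real ((fun x => (q x, β x)) ⁻¹' {(w, b)}) / μ.real (β ⁻¹' {b}) *
          Real.negMulLog (μ.real (β ⁻¹' {b}))) := by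
    rw [mapEntropy, Fintype.sum_prod_type_right]
    exact Finset.sum_le_sum fun b _ => Finset.sum_le_sum fun w _ => hstep b w
  have h2 : ∀ b, ∑ w, μ.real ((fun x => (q x, β x)) ⁻¹' {(w, b)}) / μ.real (β ⁻¹' {b}) *
      Real.negMulLog (μ.real (β ⁻¹' {b})) = Real.negMulLog (μ.real (β ⁻¹' {b})) := by
    intro b
    rw [← Finset.sum_mul, ← Finset.sum_div, hsumw]
    rcases eq_or_ne (μ.real (β ⁻¹' {b})) 0 with h | h
    · simp [h]
    · rw [div_self h, one_mul]
  have h3 : ∑ b, ∑ _w : S, ε / (Fintype.card S + 1) * μ.real (β ⁻¹' {b}) ≤ ε := by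
    simp only [Finset.sum_const, Finset.card_univ, nsmul_eq_mul]
    rw [← Finset.mul_sum, ← Finset.mul_sum, sum_measureReal_fiber μ hβ, mul_one, ← mul_div_assoc,
      div_le_iff₀ (by positivity)]
    nlinarith
  simp only [Finset.sum_add_distrib, h2] at h1
  rw [Finset.sum_comm] at h1
  simp only [hsplit] at h1
  rw [hH]
  have h4 : mapEntropy μ β = ∑ b, Real.negMulLog (μ.real (β ⁻¹' {b})) := rfl
  linarith

theorem partitionEntropy_le_integral_ergodicComponent [IsProbabilityMeasure μ]
    (hf : MeasurePreserving f μ μ) {p : X → S} (hp : MeasurableFibers p) :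
    Integrable (fun x => partitionEntropy f (ergodicComponent f μ x) p) μ ∧
      partitionEntropy f μ p ≤ ∫ x, partitionEntropy f (ergodicComponent f μ x) p ∂μ := by
  classical
  have hinv := ae_measurePreserving_ergodicComponent hf
  have hmeas : ∀ n : ℕ, AEStronglyMeasurable
      (fun x => mapEntropy (ergodicComponent f μ x) (itinerary f p n) / n) μ := fun n =>
    ((measurable_mapEntropy_ergodicComponent (hp.itinerary hf.measurable n)).div_const
      _).aestronglyMeasurable
  have hlim : ∀ᵐ x ∂μ, Tendsto
      (fun n : ℕ => mapEntropy (ergodicComponent f μ x) (itinerary f p n) / n) atTop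
      (𝓝 (partitionEntropy f (ergodicComponent f μ x) p)) :=
    hinv.mono fun x hx => tendsto_partitionEntropy hx hp
  have hbound : ∀ n : ℕ, ∀ᵐ x ∂μ,
      ‖mapEntropy (ergodicComponent f μ x) (itinerary f p n) / n‖ ≤ Fintype.card S := by
    intro n
    filter_upwards [hinv] with x hx
    rw [Real.norm_of_nonneg (div_nonneg (mapEntropy_nonneg _ _) n.cast_nonneg)]
    exact div_le_of_le_mul₀ n.cast_nonneg (by positivity)
      (by rw [mul_comm]; exact mapEntropy_itinerary_le hx hp n)
  constructor
  · refine Integrable.of_bound (aestronglyMeasurable_of_tendsto_ae atTop hmeas hlim)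
      (Fintype.card S) ?_
    filter_upwards [ae_all_iff.2 hbound, hlim] with x h1 h2
    exact le_of_tendsto' h2.norm h1
  · refine ge_of_tendsto (tendsto_integral_of_dominated_convergence (fun _ => (Fintype.card S : ℝ))
      hmeas (integrable_const _) hbound hlim) ?_
    filter_upwards [eventually_gt_atTop 0] with k hk
    have hk' : (0 : ℝ) < k := by exact_mod_cast hk
    rw [integral_div, le_div_iff₀ hk']
    refine le_of_forall_pos_le_add fun ε hε => ?_
    obtain ⟨M, β, hβ, hβf, h⟩ := exists_invariant_approx (f := f) (μ := μ)
      (hp.itinerary hf.measurable k) hε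
    have := partitionEntropy_le_of_invariant hf hp hβ hβf hk
    rw [le_div_iff₀ hk'] at this
    linarith

end EntropyDecomposition

section EquilibriumStates

open ProbabilityTheory

variable {X : Type*} [MetricSpace X] [CompactSpace X] [MeasurableSpace X] [BorelSpace X]
variable {f : X → X} {μ ν : Measure X} {φ ψ : X → ℝ}

theorem ae_measEntropy_ergodicComponent_eq [IsProbabilityMeasure μ] (hf : MeasurePreserving f μ μ)
    {D : X → ℝ} (hD : Integrable D μ)
    (hle : ∀ᵐ x ∂μ, measEntropy f (ergodicComponent f μ x) ≤ D x)
    (hint : ((∫ x, D x ∂μ : ℝ) : EReal) ≤ measEntropy f μ) :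
    ∀ᵐ x ∂μ, measEntropy f (ergodicComponent f μ x) = D x := by
  have hinv := ae_measurePreserving_ergodicComponent hf
  have hex : ∀ j : ℕ, ∃ k, ∃ p : X → Fin k, MeasurableFibers p ∧
      ∫ x, D x ∂μ - 1 / ((j : ℝ) + 1) < partitionEntropy f μ p := by
    intro j
    have : (0 : ℝ) < 1 / ((j : ℝ) + 1) := by positivity
    obtain ⟨k, p, hp, h⟩ := exists_lt_partitionEntropy hf (lt_of_lt_of_le
      (EReal.coe_lt_coe_iff.2 (sub_lt_self (∫ x, D x ∂μ) this)) hint)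
    exact ⟨k, p, hp, EReal.coe_lt_coe_iff.1 h⟩
  choose k p hp hlt using hex
  set G : ℕ → X → ℝ := fun j x => D x - partitionEntropy f (ergodicComponent f μ x) (p j)
  have hcomp := fun j => partitionEntropy_le_integral_ergodicComponent hf (hp j)
  have hGi : ∀ j, Integrable (G j) μ := fun j => hD.sub (hcomp j).1
  have hG0 : ∀ j, 0 ≤ᵐ[μ] G j := by
    intro j
    filter_upwards [hinv, hle] with x h1 h2
    exact sub_nonneg.2
      (EReal.coe_le_coe_iff.1 ((partitionEntropy_le_measEntropy h1 (hp j)).trans h2))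
  have hGint : ∀ j : ℕ, ∫⁻ x, ⨅ i, ENNReal.ofReal (G i x) ∂μ ≤
      ENNReal.ofReal (1 / ((j : ℝ) + 1)) := by
    intro j
    refine (lintegral_mono fun x => iInf_le _ j).trans ?_
    rw [← ofReal_integral_eq_lintegral_ofReal (hGi j) (hG0 j)]
    refine ENNReal.ofReal_le_ofReal ?_
    rw [integral_sub hD (hcomp j).1]
    linarith [(hcomp j).2, hlt j]
  have hzero : ∫⁻ x, ⨅ i, ENNReal.ofReal (G i x) ∂μ = 0 := by
    have hlim := ENNReal.tendsto_ofReal tendsto_one_div_add_atTop_nhds_zero_nat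
    rw [ENNReal.ofReal_zero] at hlim
    exact le_antisymm (ge_of_tendsto' hlim hGint) zero_le
  rw [lintegral_eq_zero_iff' (AEMeasurable.iInf fun i => (hGi i).aemeasurable.ennreal_ofReal)]
    at hzero
  filter_upwards [hinv, hle, hzero] with x h1 h2 h3
  refine le_antisymm h2 (le_of_not_gt fun hlt => ?_)
  obtain ⟨c, hc, hcD⟩ := EReal.lt_iff_exists_real_btwn.1 hlt
  have h4 : ENNReal.ofReal (D x - c) ≤ ⨅ i, ENNReal.ofReal (G i x) := le_iInf fun i =>
    ENNReal.ofReal_le_ofReal (sub_le_sub_left (EReal.coe_le_coe_iff.1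
      ((partitionEntropy_le_measEntropy h1 (hp i)).trans hc.le)) _)
  rw [h3, Pi.zero_apply, nonpos_iff_eq_zero, ENNReal.ofReal_eq_zero] at h4
  linarith [EReal.coe_lt_coe_iff.1 hcD]

theorem mem_invMeasures_iff (hf : Measurable f) :
    μ ∈ invMeasures f ↔ IsProbabilityMeasure μ ∧ MeasurePreserving f μ μ := by
  refine and_congr_right fun _ => ⟨fun h => ⟨hf, Measure.ext fun s hs => ?_⟩, fun h s hs =>
    h.measure_preimage hs.nullMeasurableSet⟩
  rw [Measure.map_apply hf hs, h s hs]

theorem exists_measEntropy_eq_coe [IsProbabilityMeasure μ] (hf : Continuous f)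
    (hμ : MeasurePreserving f μ μ) (htop : topEntropy f < ⊤) :
    ∃ a : ℝ, measEntropy f μ = a := by
  obtain ⟨β, hβ, -⟩ := EReal.lt_iff_exists_real_btwn.1 htop
  have h := measEntropy_le_of_inducedPressure_lt (φ := fun _ => 0) (ψ := fun _ => 1) hf hμ
    continuous_const continuous_const (fun _ => one_pos) hβ
  exact ⟨_, (EReal.coe_toReal (ne_top_of_le_ne_top (EReal.coe_ne_top _) h)
    (ne_bot_of_le_ne_bot EReal.zero_ne_bot (measEntropy_nonneg hμ))).symm⟩

theorem integral_pos_of_continuous [IsProbabilityMeasure μ] (hψ : Continuous ψ)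
    (hψpos : ∀ x, 0 < ψ x) : 0 < ∫ x, ψ x ∂μ := by
  rw [integral_pos_iff_support_of_nonneg (fun x => (hψpos x).le) (integrable_of_continuous hψ),
    Function.support_eq_univ fun x => (hψpos x).ne']
  simp

theorem exists_inducedPressure_eq_coe (hf : Continuous f) (htop : topEntropy f < ⊤)
    (hμ : μ ∈ equilibriumStates f ψ φ) : ∃ P : ℝ, inducedPressure f ψ φ = P := by
  obtain ⟨_, hmp⟩ := (mem_invMeasures_iff hf.measurable).1 hμ.1
  obtain ⟨a, ha⟩ := exists_measEntropy_eq_coe hf hmp htop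
  refine ⟨(a + ∫ x, φ x ∂μ) / ∫ x, ψ x ∂μ, ?_⟩
  rw [hμ.2, ha, EReal.coe_div, EReal.coe_add]

variable {P : ℝ}

theorem measEntropy_le_of_inducedPressure_eq [IsProbabilityMeasure μ] (hf : Continuous f)
    (hμ : MeasurePreserving f μ μ) (hφ : Continuous φ) (hψ : Continuous ψ)
    (hψpos : ∀ x, 0 < ψ x) (hP : inducedPressure f ψ φ = P) :
    measEntropy f μ ≤ ((P * ∫ x, ψ x ∂μ - ∫ x, φ x ∂μ : ℝ) : EReal) := by
  refine le_of_not_gt fun hlt => ?_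
  obtain ⟨c, hc, hcμ⟩ := EReal.lt_iff_exists_real_btwn.1 hlt
  rw [EReal.coe_lt_coe_iff] at hc
  have hpos := integral_pos_of_continuous (μ := μ) hψ hψpos
  have h := measEntropy_le_of_inducedPressure_lt (β := (c + ∫ x, φ x ∂μ) / ∫ x, ψ x ∂μ) hf hμ hφ hψ
    hψpos (by
      rw [hP, EReal.coe_lt_coe_iff, lt_div_iff₀ hpos]
      linarith)
  rw [div_mul_cancel₀ _ hpos.ne', add_sub_cancel_right] at h
  exact absurd h hcμ.not_ge

theorem mem_equilibriumStates_iff [IsProbabilityMeasure μ] (hf : Continuous f)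
    (hμ : MeasurePreserving f μ μ) (htop : topEntropy f < ⊤) (hψ : Continuous ψ)
    (hψpos : ∀ x, 0 < ψ x) (hP : inducedPressure f ψ φ = P) :
    μ ∈ equilibriumStates f ψ φ ↔
      measEntropy f μ = ((P * ∫ x, ψ x ∂μ - ∫ x, φ x ∂μ : ℝ) : EReal) := by
  have hpos := integral_pos_of_continuous (μ := μ) hψ hψpos
  obtain ⟨a, ha⟩ := exists_measEntropy_eq_coe hf hμ htop
  have h : μ ∈ invMeasures f := (mem_invMeasures_iff hf.measurable).2 ⟨‹_›, hμ⟩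
  rw [equilibriumStates, mem_ofPred_eq, and_iff_right h, hP, ha, ← EReal.coe_add, ← EReal.coe_div,
    EReal.coe_eq_coe_iff, EReal.coe_eq_coe_iff, eq_div_iff hpos.ne']
  constructor <;> intro h <;> linarith

theorem mixture_mem_equilibriumStates_iff [IsProbabilityMeasure μ] [IsProbabilityMeasure ν]
    (hf : Continuous f) (hμ : MeasurePreserving f μ μ) (hν : MeasurePreserving f ν ν)
    (htop : topEntropy f < ⊤) (hφ : Continuous φ) (hψ : Continuous ψ)
    (hψpos : ∀ x, 0 < ψ x) (hP : inducedPressure f ψ φ = P) {t : ℝ} (h0 : 0 < t) (h1 : t < 1) :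
    mixture t μ ν ∈ equilibriumStates f ψ φ ↔
      μ ∈ equilibriumStates f ψ φ ∧ ν ∈ equilibriumStates f ψ φ := by
  have := isProbabilityMeasure_mixture (μ := μ) (ν := ν) h0.le h1.le
  obtain ⟨a, ha⟩ := exists_measEntropy_eq_coe hf hμ htop
  obtain ⟨b, hb⟩ := exists_measEntropy_eq_coe hf hν htop
  have hμle := measEntropy_le_of_inducedPressure_eq hf hμ hφ hψ hψpos hP
  have hνle := measEntropy_le_of_inducedPressure_eq hf hν hφ hψ hψpos hP
  rw [mem_equilibriumStates_iff hf (measurePreserving_mixture hμ hν) htop hψ hψpos hP,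
    mem_equilibriumStates_iff hf hμ htop hψ hψpos hP,
    mem_equilibriumStates_iff hf hν htop hψ hψpos hP,
    measEntropy_mixture hμ hν h0.le h1.le ha hb,
    integral_mixture h0.le h1.le (integrable_of_continuous hφ) (integrable_of_continuous hφ),
    integral_mixture h0.le h1.le (integrable_of_continuous hψ) (integrable_of_continuous hψ),
    ha, hb]
  rw [ha, EReal.coe_le_coe_iff] at hμle
  rw [hb, EReal.coe_le_coe_iff] at hνle
  simp only [EReal.coe_eq_coe_iff]
  set u := P * ∫ x, ψ x ∂μ - ∫ x, φ x ∂μ with hu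
  set v := P * ∫ x, ψ x ∂ν - ∫ x, φ x ∂ν with hv
  have hsplit : P * (t * ∫ x, ψ x ∂μ + (1 - t) * ∫ x, ψ x ∂ν) -
      (t * ∫ x, φ x ∂μ + (1 - t) * ∫ x, φ x ∂ν) = t * u + (1 - t) * v := by
    rw [hu, hv]
    ring
  rw [hsplit]
  constructor
  · intro h
    have h2 : t * (u - a) + (1 - t) * (v - b) = 0 := by linarith
    have h3 := mul_nonneg h0.le (sub_nonneg.2 hμle)
    have h4 := mul_nonneg (sub_nonneg.2 h1.le) (sub_nonneg.2 hνle)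
    have h5 : t * (u - a) = 0 := by linarith
    have h6 : (1 - t) * (v - b) = 0 := by linarith
    rw [mul_eq_zero] at h5 h6
    constructor
    · linarith [h5.resolve_left h0.ne']
    · linarith [h6.resolve_left (sub_pos.2 h1).ne']
  · rintro ⟨rfl, rfl⟩
    rfl

theorem ergodic_of_isExtremePointOf (hf : Continuous f) (htop : topEntropy f < ⊤)
    (hφ : Continuous φ) (hψ : Continuous ψ) (hψpos : ∀ x, 0 < ψ x)
    (h : IsExtremePointOf (equilibriumStates f ψ φ) μ) : Ergodic f μ := by
  obtain ⟨hμ, hext⟩ := h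
  obtain ⟨P, hP⟩ := exists_inducedPressure_eq_coe hf htop hμ
  obtain ⟨_, hmp⟩ := (mem_invMeasures_iff hf.measurable).1 hμ.1
  refine ⟨hmp, ⟨fun {s} hsm hfs => ?_⟩⟩
  by_contra H
  obtain ⟨hs, hs'⟩ : μ s ≠ 0 ∧ μ sᶜ ≠ 0 := by
    simpa [eventuallyConst_set, ae_iff, and_comm] using! H
  have hpres : ∀ {A : Set X}, MeasurableSet A → f ⁻¹' A = A →
      MeasurePreserving f (μ[|A]) (μ[|A]) := by
    intro A hA hfA
    refine MeasurePreserving.smul_measure ?_ _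
    convert! hmp.restrict_preimage hA
    exact hfA.symm
  have := cond_isProbabilityMeasure hs
  have := cond_isProbabilityMeasure hs'
  have hreal : μ.real sᶜ = 1 - μ.real s := probReal_compl_eq_one_sub hsm
  have hpos : 0 < μ.real s := ENNReal.toReal_pos hs (by finiteness)
  have hpos' : 0 < μ.real sᶜ := ENNReal.toReal_pos hs' (by finiteness)
  have hdecomp : mixture (μ.real s) (μ[|s]) (μ[|sᶜ]) = μ := by
    rw [mixture, ← hreal, ofReal_measureReal, ofReal_measureReal, ProbabilityTheory.cond,
      ProbabilityTheory.cond, smul_smul, smul_smul, ENNReal.mul_inv_cancel hs (by finiteness),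
      ENNReal.mul_inv_cancel hs' (by finiteness), one_smul, one_smul,
      Measure.restrict_add_restrict_compl hsm]
  have hmem := (mixture_mem_equilibriumStates_iff hf (hpres hsm hfs)
    (hpres hsm.compl (by rw [preimage_compl, hfs])) htop hφ hψ hψpos hP hpos
    (by linarith)).1 (hdecomp.symm ▸ hμ)
  have hcond := (hext _ hmem.1 _ hmem.2 _ hpos (by linarith) hdecomp.symm).1
  rw [← hcond] at hs'
  simp [ProbabilityTheory.cond_apply, hsm] at hs'

theorem isExtremePointOf_of_ergodic (hf : Measurable f) (hμ : μ ∈ equilibriumStates f ψ φ)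
    (herg : Ergodic f μ) : IsExtremePointOf (equilibriumStates f ψ φ) μ := by
  refine ⟨hμ, fun μ₁ h₁ μ₂ h₂ p hp0 hp1 hp => ?_⟩
  have := hμ.1.1
  obtain ⟨_, hmp₁⟩ := (mem_invMeasures_iff hf).1 h₁.1
  obtain ⟨_, hmp₂⟩ := (mem_invMeasures_iff hf).1 h₂.1
  constructor
  · refine herg.eq_of_absolutelyContinuous hmp₁ ?_
    rw [hp]
    exact (Measure.absolutelyContinuous_smul (ENNReal.ofReal_pos.2 hp0).ne').add_right _
  · refine herg.eq_of_absolutelyContinuous hmp₂ ?_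
    rw [hp, add_comm]
    exact (Measure.absolutelyContinuous_smul
      (ENNReal.ofReal_pos.2 (sub_pos.2 hp1)).ne').add_right _

theorem exists_ergodic_mem_equilibriumStates (hf : Continuous f) (htop : topEntropy f < ⊤)
    (hφ : Continuous φ) (hψ : Continuous ψ) (hψpos : ∀ x, 0 < ψ x)
    (hμ : μ ∈ equilibriumStates f ψ φ) : ∃ ν ∈ equilibriumStates f ψ φ, Ergodic f ν := by
  obtain ⟨P, hP⟩ := exists_inducedPressure_eq_coe hf htop hμ
  obtain ⟨_, hmp⟩ := (mem_invMeasures_iff hf.measurable).1 hμ.1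
  have hφi := integral_integral_ergodicComponent (f := f) (integrable_of_continuous (μ := μ) hφ)
  have hψi := integral_integral_ergodicComponent (f := f) (integrable_of_continuous (μ := μ) hψ)
  have hinv := ae_measurePreserving_ergodicComponent hmp
  have heq := ae_measEntropy_ergodicComponent_eq hmp ((hψi.1.const_mul P).sub hφi.1)
    (hinv.mono fun x hx => measEntropy_le_of_inducedPressure_eq hf hx hφ hψ hψpos hP) (by
      rw [(mem_equilibriumStates_iff hf hmp htop hψ hψpos hP).1 hμ]
      simp only [Pi.sub_apply]
      rw [integral_sub (hψi.1.const_mul P) hφi.1, integral_const_mul, hψi.2, hφi.2])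
  obtain ⟨x, ⟨hx, hxe⟩, hxeq⟩ :=
    ((hinv.and (ae_ergodic_ergodicComponent hmp)).and heq).exists
  exact ⟨_, (mem_equilibriumStates_iff hf hx htop hψ hψpos hP).2 hxeq, hxe⟩

end EquilibriumStates

/-- For `h_top(f) < ∞` and continuous `φ, ψ` with `ψ > 0`:
(i) the set `M_{ψ,φ}(X,f)` of equilibrium states is convex; (ii) its extreme points are
exactly its ergodic members; (iii) if it is non-empty then it contains an ergodic measure. -/
theorem equilibriumStates_convex_extreme_ergodic
    {X : Type*} [MetricSpace X] [CompactSpace X] [Nonempty X]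
    [MeasurableSpace X] [BorelSpace X]
    (f : X → X) (hf : Continuous f)
    (φ ψ : X → ℝ) (hφ : Continuous φ) (hψ : Continuous ψ) (hψpos : ∀ x, 0 < ψ x)
    (htop : topEntropy f < ⊤) :
    (∀ μ ∈ equilibriumStates f ψ φ, ∀ ν ∈ equilibriumStates f ψ φ, ∀ p : ℝ,
        0 ≤ p → p ≤ 1 →
        (ENNReal.ofReal p • μ + ENNReal.ofReal (1 - p) • ν) ∈ equilibriumStates f ψ φ) ∧
    (∀ μ : Measure X, IsExtremePointOf (equilibriumStates f ψ φ) μ ↔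
        (μ ∈ equilibriumStates f ψ φ ∧ Ergodic f μ)) ∧
    ((equilibriumStates f ψ φ).Nonempty → ∃ μ ∈ equilibriumStates f ψ φ, Ergodic f μ) := by
  refine ⟨fun μ hμ ν hν p hp0 hp1 => ?_, fun μ => ⟨fun h => ⟨h.1, ?_⟩, fun h => ?_⟩, ?_⟩
  · rcases hp0.eq_or_lt with rfl | hp0
    · simpa using hν
    rcases hp1.eq_or_lt with rfl | hp1
    · simpa using hμ
    obtain ⟨P, hP⟩ := exists_inducedPressure_eq_coe hf htop hμ
    obtain ⟨_, hmμ⟩ := (mem_invMeasures_iff hf.measurable).1 hμ.1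
    obtain ⟨_, hmν⟩ := (mem_invMeasures_iff hf.measurable).1 hν.1
    exact (mixture_mem_equilibriumStates_iff hf hmμ hmν htop hφ hψ hψpos hP hp0 hp1).2 ⟨hμ, hν⟩
  · exact ergodic_of_isExtremePointOf hf htop hφ hψ hψpos h
  · exact isExtremePointOf_of_ergodic hf.measurable h.1 h.2
  · rintro ⟨μ, hμ⟩
    exact exists_ergodic_mem_equilibriumStates hf htop hφ hψ hψpos hμ
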